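/- arXiv:1303.6534 — 11 statements merged into one kernel-verified Lean document; each statement's English description precedes it below -/
import Mathlib

section
/- Let k ∈ ℂ and define P_A(x) = (k²x² − 1)(x² − 1) and F_A(x1,x2,x3) = ½(k²x1²x2² − k²x1² − k²x2² + 1)x3² + (1 − k²)x1x2x3 + ½(x1² + x2² − k²x1²x2² − 1). Then F_A is strongly discriminantly separable with respect to P_A; that is, for every permutation (i,j,k') of (1,2,3), the discriminant of F_A with respect to x_i equals P_A(x_j)·P_A(x_{k'}) identically. -/
/-- `F(x1,x2,x3)` is quadratic in its first variable, written `F = A x1² + B x1 + C`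
with `A,B,C` depending on `(x2,x3)`, and its discriminant `B² - 4AC` equals `D`. -/
def IsDiscWrt1 (F : ℂ → ℂ → ℂ → ℂ) (D : ℂ → ℂ → ℂ) : Prop :=
  ∃ A B C : ℂ → ℂ → ℂ,
    (∀ x1 x2 x3, F x1 x2 x3 = A x2 x3 * x1 ^ 2 + B x2 x3 * x1 + C x2 x3) ∧
    (∀ x2 x3, (B x2 x3) ^ 2 - 4 * A x2 x3 * C x2 x3 = D x2 x3)

def IsDiscWrt2 (F : ℂ → ℂ → ℂ → ℂ) (D : ℂ → ℂ → ℂ) : Prop :=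
  ∃ A B C : ℂ → ℂ → ℂ,
    (∀ x1 x2 x3, F x1 x2 x3 = A x1 x3 * x2 ^ 2 + B x1 x3 * x2 + C x1 x3) ∧
    (∀ x1 x3, (B x1 x3) ^ 2 - 4 * A x1 x3 * C x1 x3 = D x1 x3)

def IsDiscWrt3 (F : ℂ → ℂ → ℂ → ℂ) (D : ℂ → ℂ → ℂ) : Prop :=
  ∃ A B C : ℂ → ℂ → ℂ,
    (∀ x1 x2 x3, F x1 x2 x3 = A x1 x2 * x3 ^ 2 + B x1 x2 * x3 + C x1 x2) ∧
    (∀ x1 x2, (B x1 x2) ^ 2 - 4 * A x1 x2 * C x1 x2 = D x1 x2)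

/-- `F` is strongly discriminantly separable with respect to `P`:
`D_{x_i} F = P(x_j) P(x_k)` for every permutation `(i,j,k)` of `(1,2,3)`. -/
def StronglyDiscSep (F : ℂ → ℂ → ℂ → ℂ) (P : ℂ → ℂ) : Prop :=
  IsDiscWrt1 F (fun x2 x3 => P x2 * P x3) ∧
  IsDiscWrt2 F (fun x1 x3 => P x1 * P x3) ∧
  IsDiscWrt3 F (fun x1 x2 => P x1 * P x2)

/-- Case (A): `P_A(x) = (k²x² - 1)(x² - 1)`. -/
def PA (k x : ℂ) : ℂ := (k ^ 2 * x ^ 2 - 1) * (x ^ 2 - 1)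

/-- Case (A): the strongly discriminantly separable polynomial `F_A`. -/
noncomputable def FA (k x1 x2 x3 : ℂ) : ℂ :=
  (1 / 2) * (k ^ 2 * x1 ^ 2 * x2 ^ 2 - k ^ 2 * x1 ^ 2 - k ^ 2 * x2 ^ 2 + 1) * x3 ^ 2
    + (1 - k ^ 2) * x1 * x2 * x3
    + (1 / 2) * (x1 ^ 2 + x2 ^ 2 - k ^ 2 * x1 ^ 2 * x2 ^ 2 - 1)

theorem statement0 (k : ℂ) : StronglyDiscSep (FA k) (PA k) := by
  -- `FA k` is symmetric, so the same three coefficients serve for each variable.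
  let A : ℂ → ℂ → ℂ := fun x y =>
    (1 / 2) * (k ^ 2 * x ^ 2 * y ^ 2 - k ^ 2 * x ^ 2 - k ^ 2 * y ^ 2 + 1)
  let B : ℂ → ℂ → ℂ := fun x y => (1 - k ^ 2) * x * y
  let C : ℂ → ℂ → ℂ := fun x y =>
    (1 / 2) * (x ^ 2 + y ^ 2 - k ^ 2 * x ^ 2 * y ^ 2 - 1)
  have disc (x y : ℂ) : B x y ^ 2 - 4 * A x y * C x y = PA k x * PA k y := by
    simp only [A, B, C, PA]
    ring
  refine ⟨⟨A, B, C, fun x1 x2 x3 => ?_, disc⟩, ⟨A, B, C, fun x1 x2 x3 => ?_, disc⟩,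
    ⟨A, B, C, fun _ _ _ => rfl, disc⟩⟩
  all_goals
    simp only [A, B, C, FA]
    ring
end

section
/- Let F ∈ ℂ[x1,x2,x3] be a polynomial of degree at most 2 in each variable such that for each i ∈ {1,2,3} the discriminant of F with respect to x_i is identically equal to 1. Then there exist λ, μ, ν ∈ ℂ with μ² − 4λν = 1 and signs ε1, ε2, ε3 ∈ {1,−1} such that F(x1,x2,x3) = λ(ε1x1 + ε2x2 + ε3x3)² + μ(ε1x1 + ε2x2 + ε3x3) + ν. -/
/-- A complex quadratic polynomial function determines its coefficients. -/
lemma quadratic_coeff_unique {a b c a' b' c' : ℂ}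
    (h : ∀ x : ℂ, a * x ^ 2 + b * x + c = a' * x ^ 2 + b' * x + c') :
    a = a' ∧ b = b' ∧ c = c' := by
  have h0 := h 0
  have h1 := h 1
  have h2 := h (-1)
  refine ⟨?_, ?_, ?_⟩
  · linear_combination (h1 + h2) / 2 - h0
  · linear_combination (h1 - h2) / 2
  · linear_combination h0

/-- A vanishing complex quartic polynomial function has vanishing coefficients. -/
lemma quartic_coeff_eq_zero {a b c d e : ℂ}
    (h : ∀ x : ℂ, a * x ^ 4 + b * x ^ 3 + c * x ^ 2 + d * x + e = 0) :
    a = 0 ∧ b = 0 ∧ c = 0 ∧ d = 0 ∧ e = 0 := by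
  have h0 := h 0
  have h1 := h 1
  have h2 := h (-1)
  have h3 := h 2
  have h4 := h (-2)
  refine ⟨?_, ?_, ?_, ?_, ?_⟩
  · linear_combination (h3 + h4 - 4 * h1 - 4 * h2 + 6 * h0) / 24
  · linear_combination (h3 - h4 - 2 * h1 + 2 * h2) / 12
  · linear_combination (-h3 - h4 + 16 * h1 + 16 * h2 - 30 * h0) / 24
  · linear_combination (-h3 + h4 + 8 * h1 - 8 * h2) / 12
  · linear_combination h0

/-- The coefficient equations obtained from
`(a₁₂ y² + a₁₁ y + a₁₀)² - 4 (a₂₂ y² + a₂₁ y + a₂₀) (a₀₂ y² + a₀₁ y + a₀₀) = 1`. -/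
lemma coeff_eqs_of_disc_eq_one {a22 a21 a20 a12 a11 a10 a02 a01 a00 : ℂ}
    (h : ∀ y : ℂ, (a12 * y ^ 2 + a11 * y + a10) ^ 2
      - 4 * (a22 * y ^ 2 + a21 * y + a20) * (a02 * y ^ 2 + a01 * y + a00) = 1) :
    a12 ^ 2 = 4 * a22 * a02 ∧ a12 * a11 = 2 * (a22 * a01 + a21 * a02) ∧
    a11 ^ 2 + 2 * a12 * a10 = 4 * (a22 * a00 + a21 * a01 + a20 * a02) ∧
    a11 * a10 = 2 * (a21 * a00 + a20 * a01) ∧ a10 ^ 2 - 4 * a20 * a00 = 1 := by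
  obtain ⟨h4, h3, h2, h1, h0⟩ := quartic_coeff_eq_zero
    (a := a12 ^ 2 - 4 * a22 * a02) (b := 2 * a12 * a11 - 4 * (a22 * a01 + a21 * a02))
    (c := a11 ^ 2 + 2 * a12 * a10 - 4 * (a22 * a00 + a21 * a01 + a20 * a02))
    (d := 2 * a11 * a10 - 4 * (a21 * a00 + a20 * a01))
    (e := a10 ^ 2 - 4 * a20 * a00 - 1) (fun y ↦ by linear_combination h y)
  refine ⟨?_, ?_, ?_, ?_, ?_⟩
  · linear_combination h4
  · linear_combination h3 / 2
  · linear_combination h2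
  · linear_combination h1 / 2
  · linear_combination h0

/-- A biquadratic polynomial whose two discriminants are both identically `1` has no `x²y²` term. -/
lemma top_coeff_eq_zero_of_disc_eq_one {a22 a21 a20 a12 a11 a10 a02 a01 a00 : ℂ}
    (h : ∀ y : ℂ, (a12 * y ^ 2 + a11 * y + a10) ^ 2
      - 4 * (a22 * y ^ 2 + a21 * y + a20) * (a02 * y ^ 2 + a01 * y + a00) = 1)
    (h' : ∀ x : ℂ, (a21 * x ^ 2 + a11 * x + a01) ^ 2
      - 4 * (a22 * x ^ 2 + a12 * x + a02) * (a20 * x ^ 2 + a10 * x + a00) = 1) :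
    a22 = 0 := by
  obtain ⟨p4, p3, p2, p1, p0⟩ := coeff_eqs_of_disc_eq_one h
  obtain ⟨q4, q3, q2, q1, q0⟩ := coeff_eqs_of_disc_eq_one h'
  by_contra ha
  obtain ⟨s, rfl⟩ : ∃ s, a12 = 2 * a22 * s := ⟨a12 / (2 * a22), by field_simp⟩
  obtain ⟨t, rfl⟩ : ∃ t, a21 = 2 * a22 * t := ⟨a21 / (2 * a22), by field_simp⟩
  have e02 : a02 = a22 * s ^ 2 := by
    apply mul_left_cancel₀ ha; linear_combination -p4 / 4
  have e20 : a20 = a22 * t ^ 2 := by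
    apply mul_left_cancel₀ ha; linear_combination -q4 / 4
  subst e02 e20
  have e01 : a01 = s * a11 - 2 * a22 * t * s ^ 2 := by
    apply mul_left_cancel₀ ha; linear_combination -p3 / 2
  have e10 : a10 = t * a11 - 2 * a22 * s * t ^ 2 := by
    apply mul_left_cancel₀ ha; linear_combination -q3 / 2
  subst e01 e10
  grind

/-- For a biquadratic function of two variables with both discriminants equal to `1`, the two
leading coefficients are the same constant. -/
lemma leading_coeff_eq_of_disc_eq_one {G : ℂ → ℂ → ℂ} {A B C A' B' C' : ℂ → ℂ}
    (hG : ∀ x y, G x y = A y * x ^ 2 + B y * x + C y)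
    (hD : ∀ y, B y ^ 2 - 4 * A y * C y = 1)
    (hG' : ∀ x y, G x y = A' x * y ^ 2 + B' x * y + C' x)
    (hD' : ∀ x, B' x ^ 2 - 4 * A' x * C' x = 1) (x y : ℂ) : A y = A' x := by
  have e (x y) : A y * x ^ 2 + B y * x + C y = A' x * y ^ 2 + B' x * y + C' x :=
    (hG x y).symm.trans (hG' x y)
  obtain ⟨a22, a21, a20, hA⟩ : ∃ a2 a1 a0, ∀ y, A y = a2 * y ^ 2 + a1 * y + a0 :=
    ⟨(A' 1 + A' (-1)) / 2 - A' 0, (B' 1 + B' (-1)) / 2 - B' 0, (C' 1 + C' (-1)) / 2 - C' 0,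
      fun y ↦ by linear_combination (e 1 y + e (-1) y) / 2 - e 0 y⟩
  obtain ⟨a12, a11, a10, hB⟩ : ∃ a2 a1 a0, ∀ y, B y = a2 * y ^ 2 + a1 * y + a0 :=
    ⟨(A' 1 - A' (-1)) / 2, (B' 1 - B' (-1)) / 2, (C' 1 - C' (-1)) / 2,
      fun y ↦ by linear_combination (e 1 y - e (-1) y) / 2⟩
  obtain ⟨a02, a01, a00, hC⟩ : ∃ a2 a1 a0, ∀ y, C y = a2 * y ^ 2 + a1 * y + a0 :=
    ⟨A' 0, B' 0, C' 0, fun y ↦ by linear_combination e 0 y⟩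
  have hcoeff (x) : A' x = a22 * x ^ 2 + a12 * x + a02 ∧ B' x = a21 * x ^ 2 + a11 * x + a01 ∧
      C' x = a20 * x ^ 2 + a10 * x + a00 :=
    quadratic_coeff_unique fun y ↦ by
      linear_combination -e x y + x ^ 2 * hA y + x * hB y + hC y
  have h : ∀ y : ℂ, (a12 * y ^ 2 + a11 * y + a10) ^ 2
      - 4 * (a22 * y ^ 2 + a21 * y + a20) * (a02 * y ^ 2 + a01 * y + a00) = 1 := fun y ↦ by
    rw [← hA, ← hB, ← hC, hD]
  have h' : ∀ x : ℂ, (a21 * x ^ 2 + a11 * x + a01) ^ 2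
      - 4 * (a22 * x ^ 2 + a12 * x + a02) * (a20 * x ^ 2 + a10 * x + a00) = 1 := fun x ↦ by
    rw [← (hcoeff x).1, ← (hcoeff x).2.1, ← (hcoeff x).2.2, hD']
  obtain rfl := top_coeff_eq_zero_of_disc_eq_one h h'
  obtain ⟨p4, -, p2, p1, p0⟩ := coeff_eqs_of_disc_eq_one h
  obtain ⟨q4, -, q2, q1, q0⟩ := coeff_eqs_of_disc_eq_one h'
  obtain rfl : a12 = 0 := by simpa using p4
  obtain rfl : a21 = 0 := by simpa using q4
  rw [hA, (hcoeff x).1]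
  suffices a20 = a02 by simp [this]
  by_cases h20 : a20 = 0
  · subst h20
    grind
  · by_cases h02 : a02 = 0
    · subst h02
      grind
    · have key : a20 * (a02 * a10 ^ 2 - a20 * a01 ^ 2) = 0 := by
        linear_combination (-a10 ^ 2 / 4) * p2 + (a11 * a10 / 4 + a20 * a01 / 2) * p1
      have := (mul_eq_zero.mp key).resolve_left h20
      linear_combination -this + a02 * p0 - a20 * q0


/-- Converse of case (E): if all three discriminants of a polynomial `F` of degree at most
two in each variable are identically `1`, then `F = λ(ε1x1+ε2x2+ε3x3)² + μ(ε1x1+ε2x2+ε3x3) + ν`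
with `μ² - 4λν = 1` and signs `εᵢ ∈ {1,-1}`.
(The hypothesis `StronglyDiscSep F (fun _ => 1)` encodes, via the quadratic decompositions
in each variable, that `F` has degree at most two in each variable.) -/
theorem statement5 (F : ℂ → ℂ → ℂ → ℂ)
    (hF : StronglyDiscSep F (fun _ => 1)) :
    ∃ lam mu nu e1 e2 e3 : ℂ,
      mu ^ 2 - 4 * lam * nu = 1 ∧
      (e1 = 1 ∨ e1 = -1) ∧ (e2 = 1 ∨ e2 = -1) ∧ (e3 = 1 ∨ e3 = -1) ∧
      ∀ x1 x2 x3, F x1 x2 x3 =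
        lam * (e1 * x1 + e2 * x2 + e3 * x3) ^ 2 + mu * (e1 * x1 + e2 * x2 + e3 * x3) + nu := by
  obtain ⟨⟨A1, B1, C1, h1, d1⟩, ⟨A2, B2, C2, h2, d2⟩, ⟨A3, B3, C3, h3, d3⟩⟩ := hF
  simp only [mul_one] at d1 d2 d3
  have h12 (x1 x2 x3) : A1 x2 x3 = A2 x1 x3 :=
    leading_coeff_eq_of_disc_eq_one (G := fun x y ↦ F x y x3) (A := fun y ↦ A1 y x3)
      (A' := fun x ↦ A2 x x3) (fun x y ↦ h1 x y x3) (fun y ↦ d1 y x3)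
      (fun x y ↦ h2 x y x3) (fun x ↦ d2 x x3) x1 x2
  have h13 (x1 x2 x3) : A1 x2 x3 = A3 x1 x2 :=
    leading_coeff_eq_of_disc_eq_one (G := fun x y ↦ F x x2 y) (A := fun y ↦ A1 x2 y)
      (A' := fun x ↦ A3 x x2) (fun x y ↦ h1 x x2 y) (fun y ↦ d1 x2 y)
      (fun x y ↦ h3 x x2 y) (fun x ↦ d3 x x2) x1 x3
  obtain ⟨l, hl⟩ : ∃ l, ∀ y z, A1 y z = l :=
    ⟨A1 0 0, fun y z ↦ by rw [h12 0 y z, ← h12 0 0 z, h13 0 0 z, ← h13 0 0 0]⟩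
  have hl2 (x z) : A2 x z = l := by rw [← h12 x 0 z, hl]
  have hl3 (x y) : A3 x y = l := by rw [← h13 x y 0, hl]
  simp only [hl] at h1 d1
  simp only [hl2] at h2 d2
  simp only [hl3] at h3 d3
  -- `F - l (x1² + x2² + x3²)` is affine in each variable separately.
  have hB (y z) : B1 y z = F 1 y z - F 0 y z - l := by
    linear_combination h1 0 y z - h1 1 y z
  have hC (y z) : C1 y z = F 0 y z := by linear_combination -h1 0 y z
  have hy (x y z) : F x y z = l * y ^ 2 + (F x 1 z - F x 0 z - l) * y + F x 0 z := by
    linear_combination h2 x y z + (y - 1) * h2 x 0 z - y * h2 x 1 z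
  have hz (x y z) : F x y z = l * z ^ 2 + (F x y 1 - F x y 0 - l) * z + F x y 0 := by
    linear_combination h3 x y z + (z - 1) * h3 x y 0 - z * h3 x y 1
  obtain ⟨c, d12, d13, l1, hB'⟩ : ∃ c d12 d13 l1, ∀ y z,
      B1 y z = c * y * z + d12 * y + d13 * z + l1 := by
    refine ⟨(F 1 1 1 - F 1 1 0 - F 1 0 1 + F 1 0 0) - (F 0 1 1 - F 0 1 0 - F 0 0 1 + F 0 0 0),
      (F 1 1 0 - F 1 0 0) - (F 0 1 0 - F 0 0 0), (F 1 0 1 - F 1 0 0) - (F 0 0 1 - F 0 0 0),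
      F 1 0 0 - F 0 0 0 - l, fun y z ↦ ?_⟩
    linear_combination hB y z + hy 1 y z + y * hz 1 1 z + (1 - y) * hz 1 0 z
      - hy 0 y z - y * hz 0 1 z - (1 - y) * hz 0 0 z
  obtain ⟨d23, l2, l3, n, hC'⟩ : ∃ d23 l2 l3 n, ∀ y z,
      C1 y z = l * (y ^ 2 + z ^ 2) + d23 * y * z + l2 * y + l3 * z + n := by
    refine ⟨F 0 1 1 - F 0 1 0 - F 0 0 1 + F 0 0 0, F 0 1 0 - F 0 0 0 - l,
      F 0 0 1 - F 0 0 0 - l, F 0 0 0, fun y z ↦ ?_⟩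
    linear_combination hC y z + hy 0 y z + y * hz 0 1 z + (1 - y) * hz 0 0 z
  have hFe (x y z) : F x y z = l * (x ^ 2 + y ^ 2 + z ^ 2) + c * x * y * z + d12 * x * y
      + d13 * x * z + d23 * y * z + l1 * x + l2 * y + l3 * z + n := by
    linear_combination h1 x y z + x * hB' y z + hC' y z
  have hdisc (z) := coeff_eqs_of_disc_eq_one (a22 := 0) (a21 := 0) (a20 := l) (a12 := 0)
    (a11 := c * z + d12) (a10 := d13 * z + l1) (a02 := l) (a01 := d23 * z + l2)
    (a00 := l * z ^ 2 + l3 * z + n)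
    (fun y ↦ by
      have := d1 y z
      rw [hB', hC'] at this
      linear_combination this)
  have hc : c = 0 := by
    have e0 := (hdisc 0).2.2.1
    have e1 := (hdisc 1).2.2.1
    have e2 := (hdisc (-1)).2.2.1
    have : c ^ 2 = 0 := by linear_combination (e1 + e2) / 2 - e0
    simpa using this
  subst hc
  have E2 : d12 ^ 2 = 4 * l ^ 2 := by linear_combination (hdisc 0).2.2.1
  have F1 : d12 * l1 = 2 * l * l2 := by linear_combination (hdisc 0).2.2.2.1
  have F2 : d12 * d13 = 2 * l * d23 := by
    linear_combination (hdisc 1).2.2.2.1 - (hdisc 0).2.2.2.1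
  have G0 : l1 ^ 2 - 4 * l * n = 1 := by linear_combination (hdisc 0).2.2.2.2
  have G1 : d13 * l1 = 2 * l * l3 := by
    linear_combination ((hdisc 1).2.2.2.2 - (hdisc (-1)).2.2.2.2) / 4
  have G2 : d13 ^ 2 = 4 * l ^ 2 := by
    linear_combination ((hdisc 1).2.2.2.2 + (hdisc (-1)).2.2.2.2) / 2 - (hdisc 0).2.2.2.2
  by_cases h0 : l = 0
  · subst h0
    have D12 : d12 = 0 := by simpa using E2
    have D13 : d13 = 0 := by simpa using G2
    subst D12 D13
    have hB2 (z) : B2 0 z = d23 * z + l2 := by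
      linear_combination h2 0 0 z - h2 0 1 z + hFe 0 1 z - hFe 0 0 z
    have hB3 : B3 0 0 = l3 := by
      linear_combination h3 0 0 0 - h3 0 0 1 + hFe 0 0 1 - hFe 0 0 0
    have K (z) : (d23 * z + l2) ^ 2 = 1 := by
      rw [← hB2]; linear_combination d2 0 z
    have D23 : d23 = 0 := by
      have : d23 ^ 2 = 0 := by linear_combination (K 1 + K (-1)) / 2 - K 0
      simpa using this
    subst D23
    exact ⟨0, 1, n, l1, l2, l3, by norm_num,
      sq_eq_one_iff.mp (by linear_combination G0),
      sq_eq_one_iff.mp (by linear_combination K 0),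
      sq_eq_one_iff.mp (by rw [← hB3]; linear_combination d3 0 0),
      fun x y z ↦ by rw [hFe]; ring⟩
  · have sign {d : ℂ} (hd : d ^ 2 = 4 * l ^ 2) : ∃ e, (e = 1 ∨ e = -1) ∧ d = 2 * l * e := by
      rcases sq_eq_sq_iff_eq_or_eq_neg.mp (show d ^ 2 = (2 * l) ^ 2 by linear_combination hd)
        with h | h
      · exact ⟨1, .inl rfl, by linear_combination h⟩
      · exact ⟨-1, .inr rfl, by linear_combination h⟩
    obtain ⟨e2, he2, rfl⟩ := sign E2
    obtain ⟨e3, he3, rfl⟩ := sign G2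
    have h2l : 2 * l ≠ 0 := mul_ne_zero two_ne_zero h0
    have L2 : l2 = e2 * l1 := mul_left_cancel₀ h2l (by linear_combination -F1)
    have L3 : l3 = e3 * l1 := mul_left_cancel₀ h2l (by linear_combination -G1)
    have D23 : d23 = 2 * l * e2 * e3 := mul_left_cancel₀ h2l (by linear_combination -F2)
    have s2 : e2 ^ 2 = 1 := by rcases he2 with rfl | rfl <;> norm_num
    have s3 : e3 ^ 2 = 1 := by rcases he3 with rfl | rfl <;> norm_num
    refine ⟨l, l1, n, 1, e2, e3, G0, .inl rfl, he2, he3, fun x y z ↦ ?_⟩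
    rw [hFe, L2, L3, D23]
    linear_combination -l * y ^ 2 * s2 - l * z ^ 2 * s3
end

section
/- Let F ∈ ℂ[x1,x2,x3] be a polynomial of degree at most 2 in each variable such that for every permutation (i,j,k) of (1,2,3) the discriminant of F with respect to x_i is identically equal to x_j²x_k². Then there exist λ, μ, ν ∈ ℂ with μ² − 4λν = 1 such that F is equal to one of the four polynomials: λx1²x2² + μx1x2x3 + νx3², λx1²x3² + μx1x2x3 + νx2², λx2²x3² + μx1x2x3 + νx1², or λx1²x2²x3² + μx1x2x3 + ν. -/
/-- The quadratic polynomial function with coefficients `c 0, c 1, c 2`. -/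
def quad (c : Fin 3 → ℂ) (x : ℂ) : ℂ := c 0 + c 1 * x + c 2 * x ^ 2

/-- The discriminant of the triquadratic polynomial `∑ a i j k x^i y^j z^k` with respect to `x`
equals `y² z²`. -/
def LeadDisc (a : Fin 3 → Fin 3 → Fin 3 → ℂ) : Prop :=
  ∀ y z, quad (fun j => quad (a 1 j) z) y ^ 2
    - 4 * quad (fun j => quad (a 2 j) z) y * quad (fun j => quad (a 0 j) z) y = y ^ 2 * z ^ 2

theorem LeadDisc.swap {a : Fin 3 → Fin 3 → Fin 3 → ℂ} (h : LeadDisc a) :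
    LeadDisc fun i k j => a i j k := by
  intro z y
  have := h y z
  simp only [quad] at this ⊢
  linear_combination this

theorem eq_zero_or_eq_zero_of_quad_mul_quad {c d : Fin 3 → ℂ}
    (h : ∀ y, y ≠ 0 → quad c y * quad d y = 0) : c = 0 ∨ d = 0 := by
  open Polynomial in
  have key (e : Fin 3 → ℂ) (he : C (e 0) + C (e 1) * X + C (e 2) * X ^ 2 = (0 : ℂ[X])) :
      e = 0 := by
    have hc (n : ℕ) := congrArg (fun p : ℂ[X] => p.coeff n) he
    have h0 := hc 0
    have h1 := hc 1
    have h2 := hc 2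
    simp [coeff_X, coeff_C, coeff_X_pow] at h0 h1 h2
    ext i
    fin_cases i <;> simpa
  open Polynomial in
  have hp : X * ((C (c 0) + C (c 1) * X + C (c 2) * X ^ 2) *
      (C (d 0) + C (d 1) * X + C (d 2) * X ^ 2)) = (0 : ℂ[X]) := by
    apply Polynomial.funext
    intro y
    by_cases hy : y = 0
    · simp [hy]
    · have := h y hy
      simp only [quad] at this
      simp [hy]
      simpa using this
  rcases mul_eq_zero.1 hp with h0 | h0
  · exact absurd h0 Polynomial.X_ne_zero
  · exact (mul_eq_zero.1 h0).imp (key c) (key d)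

/-- A biquadratic polynomial in `x, z` whose discriminants are `d z²` and `d x²`, `d ≠ 0`, has a
constant term in `z` that is a monomial `g x⁰` or `g x²`. -/
theorem face_coeff_eq_zero {g h k : Fin 3 → ℂ} {d : ℂ} (hd : d ≠ 0)
    (hx : ∀ z, (g 1 + h 1 * z + k 1 * z ^ 2) ^ 2
      - 4 * (g 2 + h 2 * z + k 2 * z ^ 2) * (g 0 + h 0 * z + k 0 * z ^ 2) = d * z ^ 2)
    (hz : ∀ x, quad h x ^ 2 - 4 * quad k x * quad g x = d * x ^ 2) :
    g 1 = 0 ∧ g 0 * g 2 = 0 := by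
  have e0 : g 1 ^ 2 = 4 * g 2 * g 0 := by linear_combination hx 0
  have e1 : g 1 * h 1 = 2 * (g 2 * h 0 + g 0 * h 2) := by
    linear_combination (1 / 3 : ℂ) * (hx 1 - hx (-1)) - (1 / 24 : ℂ) * (hx 2 - hx (-2))
  have h1 : g 1 = 0 := by
    by_cases h2 : g 2 = 0
    · simpa [h2] using e0
    · set x := -g 1 / (2 * g 2) with hxdef
      have hg1 : g 1 = -2 * g 2 * x := by rw [hxdef]; field_simp
      have hg0 : g 0 = g 2 * x ^ 2 := by
        apply mul_left_cancel₀ h2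
        rw [hg1] at e0
        linear_combination -(1 / 4 : ℂ) * e0
      have hh : quad h x = 0 := by
        apply mul_left_cancel₀ h2
        rw [hg1, hg0] at e1
        simp only [quad]
        linear_combination -(1 / 2 : ℂ) * e1
      have hg : quad g x = 0 := by
        simp only [quad]
        rw [hg1, hg0]
        ring
      have := hz x
      rw [hh, hg] at this
      have hx0 : x = 0 := by
        have : d * x ^ 2 = 0 := by linear_combination -this
        simpa [hd] using this
      simp [hg1, hx0]
  refine ⟨h1, ?_⟩
  rw [h1] at e0
  linear_combination -(1 / 4 : ℂ) * e0

theorem LeadDisc.face {a : Fin 3 → Fin 3 → Fin 3 → ℂ} (hx : LeadDisc a)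
    (hz : LeadDisc fun k i j => a i j k) :
    (∀ j, a 1 j 0 = 0 ∧ a 1 j 2 = 0) ∧
      ∀ j j', a 0 j 0 * a 2 j' 0 = 0 ∧ a 0 j 2 * a 2 j' 2 = 0 := by
  let s (k : Fin 3) (y : ℂ) (i : Fin 3) : ℂ := quad (fun j => a i j k) y
  have low (y : ℂ) (hy : y ≠ 0) : s 0 y 1 = 0 ∧ s 0 y 0 * s 0 y 2 = 0 := by
    refine face_coeff_eq_zero (h := s 1 y) (k := s 2 y) (pow_ne_zero 2 hy) (fun z => ?_)
      (fun x => ?_)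
    · have := hx y z
      simp only [quad, s] at this ⊢
      linear_combination this
    · have := hz x y
      simp only [quad, s] at this ⊢
      linear_combination this
  have high (y : ℂ) (hy : y ≠ 0) : s 2 y 1 = 0 ∧ s 2 y 0 * s 2 y 2 = 0 := by
    refine face_coeff_eq_zero (h := s 1 y) (k := s 0 y) (pow_ne_zero 2 hy) (fun z => ?_)
      (fun x => ?_)
    · by_cases hz0 : z = 0
      · subst hz0
        have e (z : ℂ) := hx y z
        simp only [quad, s] at e ⊢
        linear_combination (1 / 24 : ℂ) * (e 2 + e (-2) - 4 * e 1 - 4 * e (-1) + 6 * e 0)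
      · have := hx y z⁻¹
        simp only [quad, s] at this ⊢
        field_simp at this
        linear_combination this
    · have := hz x y
      simp only [quad, s] at this ⊢
      linear_combination this
  have mid (k : Fin 3) (h : ∀ y, y ≠ 0 → s k y 1 = 0 ∧ s k y 0 * s k y 2 = 0) (j : Fin 3) :
      a 1 j k = 0 := by
    have := eq_zero_or_eq_zero_of_quad_mul_quad (c := fun j => a 1 j k) (d := fun j => a 1 j k)
      fun y hy => mul_eq_zero_of_left (h y hy).1 _
    exact congrFun (or_self_iff.1 this) j
  have corner (k : Fin 3) (h : ∀ y, y ≠ 0 → s k y 1 = 0 ∧ s k y 0 * s k y 2 = 0)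
      (j j' : Fin 3) : a 0 j k * a 2 j' k = 0 := by
    rcases eq_zero_or_eq_zero_of_quad_mul_quad (c := fun j => a 0 j k) (d := fun j => a 2 j k)
      fun y hy => (h y hy).2 with h | h
    · exact mul_eq_zero_of_left (congrFun h j) _
    · exact mul_eq_zero_of_right _ (congrFun h j')
  exact ⟨fun j => ⟨mid 0 low j, mid 2 high j⟩, fun j j' => ⟨corner 0 low j j', corner 2 high j j'⟩⟩

/-- The coefficients of the quadratic polynomial interpolating `f` at `0, 1, -1`. -/
noncomputable def interp (f : ℂ → ℂ) : Fin 3 → ℂ :=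
  ![f 0, (f 1 - f (-1)) / 2, (f 1 + f (-1)) / 2 - f 0]

theorem interp_eq {f : ℂ → ℂ} {A B C : ℂ} (h : ∀ x, f x = A * x ^ 2 + B * x + C) :
    interp f = ![C, B, A] := by
  ext i
  fin_cases i <;> (simp [interp, h]; try ring)

theorem quad_interp {f : ℂ → ℂ} {A B C : ℂ} (h : ∀ x, f x = A * x ^ 2 + B * x + C) (x : ℂ) :
    f x = quad (interp f) x := by
  rw [interp_eq h, h, quad]
  simp
  ring

theorem interp_quad (c : Fin 3 → ℂ) : interp (quad c) = c := by
  ext i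
  fin_cases i <;> (simp [interp, quad]; try ring)

theorem disc_quad {c : Fin 3 → ℂ} {A B C : ℂ} (h : ∀ x, quad c x = A * x ^ 2 + B * x + C) :
    c 1 ^ 2 - 4 * c 2 * c 0 = B ^ 2 - 4 * A * C := by
  have := interp_eq h
  rw [interp_quad] at this
  simp [this]

theorem StronglyDiscSep.exists_coeff {F : ℂ → ℂ → ℂ → ℂ}
    (hF : StronglyDiscSep F (fun x => x ^ 2)) :
    ∃ a : Fin 3 → Fin 3 → Fin 3 → ℂ,
      (∀ x y z, F x y z = quad (fun i => quad (fun j => quad (a i j) z) y) x) ∧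
      LeadDisc a ∧ LeadDisc (fun j i k => a i j k) ∧ LeadDisc (fun k i j => a i j k) := by
  obtain ⟨⟨A₁, B₁, C₁, h₁, d₁⟩, ⟨A₂, B₂, C₂, h₂, d₂⟩, ⟨A₃, B₃, C₃, h₃, d₃⟩⟩ := hF
  have hex : ∃ a : Fin 3 → Fin 3 → Fin 3 → ℂ,
      ∀ x y z, F x y z = quad (fun i => quad (fun j => quad (a i j) z) y) x := by
    refine ⟨fun i j k => interp (fun x => interp (fun y => interp (F x y) k) j) i,
      fun x y z => ?_⟩
    have e₁ := quad_interp (fun x => h₁ x y z) x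
    have e₂ (x : ℂ) := quad_interp (f := fun y => F x y z) (fun y => h₂ x y z) y
    have e₃ (x y : ℂ) := quad_interp (h₃ x y) z
    simp only [quad, interp, Matrix.cons_val] at e₁ e₂ e₃ ⊢
    rw [e₁]
    simp only [e₂ 0, e₂ 1, e₂ (-1)]
    simp only [e₃ _ 0, e₃ _ 1, e₃ _ (-1)]
    ring
  obtain ⟨a, ha⟩ := hex
  refine ⟨a, ha, fun y z => ?_, fun x z => ?_, fun x y => ?_⟩
  · refine (disc_quad (c := fun i => quad (fun j => quad (a i j) z) y) fun x => ?_).trans (d₁ y z)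
    rw [← ha, h₁]
  · refine (disc_quad (c := fun j => quad (fun i => quad (a i j) z) x) fun y => ?_).trans (d₂ x z)
    rw [← h₂, ha]
    simp only [quad]
    ring
  · refine (disc_quad (c := fun k => quad (fun i => quad (fun j => a i j k) y) x)
      fun z => ?_).trans (d₃ x y)
    rw [← h₃, ha]
    simp only [quad]
    ring

/-- Converse of case (C): if `D_{x_i} F = x_j² x_k²` identically for every permutation
`(i,j,k)` of `(1,2,3)`, then `F` is one of the four families `F_{C1}, …, F_{C4}` with
`μ² - 4λν = 1`. (The hypothesis `StronglyDiscSep F (fun x => x ^ 2)` encodes, via the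
quadratic decompositions in each variable, that `F` has degree at most two in each variable.) -/
theorem statement6 (F : ℂ → ℂ → ℂ → ℂ)
    (hF : StronglyDiscSep F (fun x => x ^ 2)) :
    ∃ lam mu nu : ℂ,
      mu ^ 2 - 4 * lam * nu = 1 ∧
      ((∀ x1 x2 x3, F x1 x2 x3 = lam * x1 ^ 2 * x2 ^ 2 + mu * x1 * x2 * x3 + nu * x3 ^ 2) ∨
       (∀ x1 x2 x3, F x1 x2 x3 = lam * x1 ^ 2 * x3 ^ 2 + mu * x1 * x2 * x3 + nu * x2 ^ 2) ∨
       (∀ x1 x2 x3, F x1 x2 x3 = lam * x2 ^ 2 * x3 ^ 2 + mu * x1 * x2 * x3 + nu * x1 ^ 2) ∨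
       (∀ x1 x2 x3, F x1 x2 x3 = lam * x1 ^ 2 * x2 ^ 2 * x3 ^ 2 + mu * x1 * x2 * x3 + nu)) := by
  obtain ⟨a, ha, hx, hy, hz⟩ := hF.exists_coeff
  obtain ⟨mxz, cxz⟩ := hx.face hz
  obtain ⟨mxy, cxy⟩ := hx.swap.face hy
  obtain ⟨myz, cyz⟩ := hy.face hz.swap
  obtain ⟨myx, -⟩ := hy.swap.face hx
  obtain ⟨mzy, czy⟩ := hz.face hy.swap
  obtain ⟨-, czx⟩ := hz.swap.face hx.swap
  have hF' (x y z : ℂ) : F x y z = a 0 0 0 + a 2 2 2 * x ^ 2 * y ^ 2 * z ^ 2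
      + a 0 0 2 * z ^ 2 + a 2 2 0 * x ^ 2 * y ^ 2 + a 0 2 0 * y ^ 2 + a 2 0 2 * x ^ 2 * z ^ 2
      + a 2 0 0 * x ^ 2 + a 0 2 2 * y ^ 2 * z ^ 2 + a 1 1 1 * x * y * z := by
    simp only [ha, quad, mxz, mxy, myz, myx, mzy]
    ring
  have hdisc := hx 1 1
  simp only [quad, mxz, mxy, myz, myx, mzy] at hdisc
  have key : (a 0 0 0 = 0 ∧ a 2 2 2 = 0 ∧ a 0 2 0 = 0 ∧ a 2 0 2 = 0 ∧ a 2 0 0 = 0 ∧ a 0 2 2 = 0) ∨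
      (a 0 0 0 = 0 ∧ a 2 2 2 = 0 ∧ a 0 0 2 = 0 ∧ a 2 2 0 = 0 ∧ a 2 0 0 = 0 ∧ a 0 2 2 = 0) ∨
      (a 0 0 0 = 0 ∧ a 2 2 2 = 0 ∧ a 0 0 2 = 0 ∧ a 2 2 0 = 0 ∧ a 0 2 0 = 0 ∧ a 2 0 2 = 0) ∨
      (a 0 0 2 = 0 ∧ a 2 2 0 = 0 ∧ a 0 2 0 = 0 ∧ a 2 0 2 = 0 ∧ a 2 0 0 = 0 ∧ a 0 2 2 = 0) := by
    clear hF' hdisc ha mxz mxy myz myx mzy hx hy hz hF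
    simp only [mul_eq_zero] at cxz cxy cyz czy czx
    grind [cxz 0 0, cxz 0 2, cxz 2 0, cxz 2 2, cxy 0 2, cxy 2 0, cyz 0 0, cyz 2 2, czy 0 0,
      czy 2 2, czx 0 2, czx 2 0]
  rcases key with h | h | h | h <;> obtain ⟨h1, h2, h3, h4, h5, h6⟩ := h <;>
    simp only [h1, h2, h3, h4, h5, h6] at hF' hdisc
  · exact ⟨a 2 2 0, a 1 1 1, a 0 0 2, by linear_combination hdisc,
      .inl fun x y z => by rw [hF']; ring⟩
  · exact ⟨a 2 0 2, a 1 1 1, a 0 2 0, by linear_combination hdisc,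
      .inr <| .inl fun x y z => by rw [hF']; ring⟩
  · exact ⟨a 0 2 2, a 1 1 1, a 2 0 0, by linear_combination hdisc,
      .inr <| .inr <| .inl fun x y z => by rw [hF']; ring⟩
  · exact ⟨a 2 2 2, a 1 1 1, a 0 0 0, by linear_combination hdisc,
      .inr <| .inr <| .inr fun x y z => by rw [hF']; ring⟩
end

section
/- Let F ∈ ℂ[x1,x2,x3] be a polynomial of degree at most 2 in each variable such that for every permutation (i,j,k) of (1,2,3) the discriminant of F with respect to x_i is identically equal to x_j·x_k. Then F(x1,x2,x3) = ε·(−½(x1x2 + x2x3 + x1x3) + ¼(x1² + x2² + x3²)) for some ε ∈ {1,−1}. -/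
/-- `f` is a polynomial function of degree at most two. -/
def IsQuad (f : ℂ → ℂ) : Prop :=
  ∃ a b c : ℂ, ∀ x, f x = a * x ^ 2 + b * x + c

/-- `f` is the square of a polynomial function of degree at most one. -/
def IsSqLin (f : ℂ → ℂ) : Prop :=
  ∃ p q : ℂ, ∀ x, f x = (p * x + q) ^ 2

theorem IsSqLin.isQuad {f : ℂ → ℂ} (h : IsSqLin f) : IsQuad f := by
  obtain ⟨p, q, h⟩ := h
  exact ⟨p ^ 2, 2 * p * q, q ^ 2, fun x => by rw [h]; ring⟩

theorem isSqLin_of_disc_eq_zero {f : ℂ → ℂ} {a b c : ℂ}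
    (h : ∀ x, f x = a * x ^ 2 + b * x + c) (hd : b ^ 2 - 4 * a * c = 0) : IsSqLin f := by
  by_cases ha : a = 0
  · have hb : b = 0 := by
      subst ha
      simpa using hd
    obtain ⟨q, hq⟩ := IsAlgClosed.exists_pow_nat_eq c two_pos
    exact ⟨0, q, fun x => by rw [h, ha, hb, ← hq]; ring⟩
  · obtain ⟨p, hp⟩ := IsAlgClosed.exists_pow_nat_eq a two_pos
    have hp0 : p ≠ 0 := by
      rintro rfl
      exact ha (by simpa using hp.symm)
    refine ⟨p, b / (2 * p), fun x => ?_⟩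
    have hc : c = (b / (2 * p)) ^ 2 := by
      rw [← hp] at hd
      field_simp
      linear_combination -hd
    rw [h, hc, ← hp]
    field_simp
    ring

theorem quartic_coeff_eq_zero_s7 {c₀ c₁ c₂ c₃ c₄ : ℂ}
    (h : ∀ x : ℂ, c₄ * x ^ 4 + c₃ * x ^ 3 + c₂ * x ^ 2 + c₁ * x + c₀ = 0) :
    c₀ = 0 ∧ c₁ = 0 ∧ c₂ = 0 ∧ c₃ = 0 ∧ c₄ = 0 := by
  have h0 := h 0
  have h1 := h 1
  have h2 := h (-1)
  have h3 := h 2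
  have h4 := h (-2)
  refine ⟨?_, ?_, ?_, ?_, ?_⟩
  · linear_combination h0
  · linear_combination (2 / 3) * h1 - (2 / 3) * h2 - (1 / 12) * h3 + (1 / 12) * h4
  · linear_combination (-5 / 4) * h0 + (2 / 3) * h1 + (2 / 3) * h2 - (1 / 24) * h3 - (1 / 24) * h4
  · linear_combination (-1 / 6) * h1 + (1 / 6) * h2 + (1 / 12) * h3 - (1 / 12) * h4
  · linear_combination (1 / 4) * h0 - (1 / 6) * h1 - (1 / 6) * h2 + (1 / 24) * h3 + (1 / 24) * h4

theorem IsQuad.not_sq_eq_linear {b : ℂ → ℂ} (hb : IsQuad b) {c : ℂ} (hc : c ≠ 0) :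
    ¬ ∀ y, b y ^ 2 = c * y := by
  obtain ⟨u, v, w, hb⟩ := hb
  intro h
  obtain ⟨h0, h1, -, -, -⟩ := quartic_coeff_eq_zero_s7 (c₄ := u ^ 2) (c₃ := 2 * u * v)
    (c₂ := 2 * u * w + v ^ 2) (c₁ := 2 * v * w - c) (c₀ := w ^ 2) (fun x => by
      have := h x
      rw [hb] at this
      linear_combination this)
  have hw : w = 0 := by simpa using h0
  subst hw
  exact hc (by linear_combination -h1)

/-- If two quadratic functions have product vanishing away from `0`, one of them vanishes. -/
theorem IsQuad.eq_zero_or_eq_zero {f g : ℂ → ℂ} (hf : IsQuad f) (hg : IsQuad g)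
    (h : ∀ y, y ≠ 0 → f y * g y = 0) : (∀ y, f y = 0) ∨ (∀ y, g y = 0) := by
  open Polynomial in
  obtain ⟨a, b, c, hf⟩ := hf
  obtain ⟨a', b', c', hg⟩ := hg
  have hp : (C a * X ^ 2 + C b * X + C c) * (C a' * X ^ 2 + C b' * X + C c') = (0 : ℂ[X]) := by
    refine Polynomial.eq_zero_of_infinite_isRoot _ (Set.Infinite.mono (s := {0}ᶜ) ?_ ?_)
    · intro y hy
      have := h y hy
      rw [hf, hg] at this
      simpa [Polynomial.IsRoot] using this
    · exact (Set.finite_singleton (0 : ℂ)).infinite_compl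
  rcases mul_eq_zero.mp hp with h | h
  · left
    intro y
    simpa [hf] using congrArg (Polynomial.eval y) h
  · right
    intro y
    simpa [hg] using congrArg (Polynomial.eval y) h

theorem degenerate_of_sq_sub_eq_linear {p q r s u v w c : ℂ} (hc : c ≠ 0)
    (h : ∀ x : ℂ, (u * x ^ 2 + v * x + w) ^ 2 - 4 * (r * x + s) ^ 2 * (p * x + q) ^ 2 = c * x) :
    (p = 0 ∧ r ≠ 0 ∧ s ≠ 0) ∨ (r = 0 ∧ p ≠ 0 ∧ q ≠ 0) := by
  obtain ⟨h0, h1, h2, h3, h4⟩ := quartic_coeff_eq_zero_s7 (c₄ := u ^ 2 - 4 * (p * r) ^ 2)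
    (c₃ := 2 * u * v - 8 * (p * r) * (p * s + q * r))
    (c₂ := 2 * u * w + v ^ 2 - 4 * (2 * (p * r) * (q * s) + (p * s + q * r) ^ 2))
    (c₁ := 2 * v * w - 8 * (p * s + q * r) * (q * s) - c)
    (c₀ := w ^ 2 - 4 * (q * s) ^ 2) (fun x => by linear_combination h x)
  have hpr : p * r = 0 := by
    by_contra hpr
    have aux : ∀ t : ℂ, t ^ 2 = 1 → u = 2 * t * (p * r) → False := by
      intro t ht hu
      have ht0 : t ≠ 0 := by
        rintro rfl
        simp at ht
      have hv : v = 2 * t * (p * s + q * r) := by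
        apply mul_left_cancel₀ (mul_ne_zero ht0 hpr)
        rw [hu] at h3
        linear_combination h3 / 4 - 2 * (p * r) * (p * s + q * r) * ht
      have hw : w = 2 * t * (q * s) := by
        apply mul_left_cancel₀ (mul_ne_zero ht0 hpr)
        rw [hu, hv] at h2
        linear_combination h2 / 4 -
          (2 * (p * r) * (q * s) + (p * s + q * r) ^ 2) * ht
      rw [hv, hw] at h1
      exact hc (by linear_combination -h1 + 8 * (p * s + q * r) * (q * s) * ht)
    have : (u - 2 * (p * r)) * (u + 2 * (p * r)) = 0 := by linear_combination h4
    rcases mul_eq_zero.mp this with hu | hu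
    · exact aux 1 (by norm_num) (by linear_combination hu)
    · exact aux (-1) (by norm_num) (by linear_combination hu)
  have hu : u = 0 := by
    rw [hpr] at h4
    simpa using h4
  have hvanish : (p * s + q * r) * (q * s) ≠ 0 := by
    intro hz
    have hvw : (v * w) ^ 2 = 0 := by
      have hv2 : v ^ 2 = 4 * (p * s + q * r) ^ 2 := by
        rw [hu, hpr] at h2
        linear_combination h2
      rw [mul_pow, hv2]
      linear_combination 4 * (p * s + q * r) ^ 2 * h0 +
        16 * ((p * s + q * r) * (q * s)) * hz
    have hvw' : v * w = 0 := by simpa using hvw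
    exact hc (by linear_combination -h1 + 2 * hvw' - 8 * hz)
  obtain ⟨hm, hqs⟩ := mul_ne_zero_iff.mp hvanish
  obtain ⟨hq, hs⟩ := mul_ne_zero_iff.mp hqs
  rcases mul_eq_zero.mp hpr with hp | hr
  · refine Or.inl ⟨hp, ?_, hs⟩
    rintro rfl
    simp [hp] at hm
  · refine Or.inr ⟨hr, ?_, hq⟩
    rintro rfl
    simp [hr] at hm

section Faces

variable {G A B : ℂ → ℂ → ℂ}

theorem slice_cases (hG : ∀ y, IsSqLin fun x => G x y) (hA : ∀ y, IsSqLin fun x => A x y)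
    (hB : ∀ y, IsQuad fun x => B x y) (h : ∀ x y, B x y ^ 2 - 4 * A x y * G x y = x * y)
    {y : ℂ} (hy : y ≠ 0) :
    ((∀ x, G x y = G 0 y) ∧ ∃ r s, r ≠ 0 ∧ s ≠ 0 ∧ ∀ x, A x y = (r * x + s) ^ 2) ∨
    ((∀ x, A x y = A 0 y) ∧ ∃ r s, r ≠ 0 ∧ s ≠ 0 ∧ ∀ x, G x y = (r * x + s) ^ 2) := by
  obtain ⟨p, q, hG⟩ := hG y
  obtain ⟨r, s, hA⟩ := hA y
  obtain ⟨u, v, w, hB⟩ := hB y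
  dsimp only at hG hA hB
  rcases degenerate_of_sq_sub_eq_linear (p := p) (q := q) (r := r) (s := s) (u := u) (v := v)
    (w := w) hy (fun x => by rw [← hG, ← hA, ← hB, h, mul_comm]) with ⟨hp, hr, hs⟩ | ⟨hr, hp, hq⟩
  · exact Or.inl ⟨fun x => by simp [hG, hp], r, s, hr, hs, hA⟩
  · exact Or.inr ⟨fun x => by simp [hA, hr], p, q, hp, hq, hG⟩

theorem eq_at_zero_of_second_difference {g : ℂ → ℂ} (hg : IsSqLin g)
    (h : g 1 + g (-1) - 2 * g 0 = 0) (x : ℂ) : g x = g 0 := by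
  obtain ⟨p, q, hg⟩ := hg
  have hp : p ^ 2 = 0 := by
    simp only [hg] at h
    linear_combination h / 2
  have hp : p = 0 := by simpa using hp
  simp [hg, hp]

theorem isQuad_second_difference (hG : ∀ x, IsSqLin fun y => G x y) :
    IsQuad fun y => G 1 y + G (-1) y - 2 * G 0 y := by
  obtain ⟨a, b, c, h₁⟩ := (hG 1).isQuad
  obtain ⟨a', b', c', h₂⟩ := (hG (-1)).isQuad
  obtain ⟨a'', b'', c'', h₃⟩ := (hG 0).isQuad
  dsimp only at h₁ h₂ h₃
  exact ⟨a + a' - 2 * a'', b + b' - 2 * b'', c + c' - 2 * c'', fun y => by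
    simp only [h₁, h₂, h₃]; ring⟩

theorem indep_fst_or_indep_fst (hGx : ∀ y, IsSqLin fun x => G x y)
    (hGy : ∀ x, IsSqLin fun y => G x y)
    (hAx : ∀ y, IsSqLin fun x => A x y) (hAy : ∀ x, IsSqLin fun y => A x y)
    (hBx : ∀ y, IsQuad fun x => B x y)
    (h : ∀ x y, B x y ^ 2 - 4 * A x y * G x y = x * y) :
    (∀ x y, G x y = G 0 y) ∨ (∀ x y, A x y = A 0 y) := by
  rcases (isQuad_second_difference hGy).eq_zero_or_eq_zero (isQuad_second_difference hAy)
    (fun y hy => by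
      rcases slice_cases hGx hAx hBx h hy with ⟨hc, -⟩ | ⟨hc, -⟩
      · rw [hc 1, hc (-1)]; ring
      · rw [hc 1, hc (-1)]; ring) with h0 | h0
  · exact Or.inl fun x y => eq_at_zero_of_second_difference (hGx y) (h0 y) x
  · exact Or.inr fun x y => eq_at_zero_of_second_difference (hAx y) (h0 y) x

theorem const_of_indep_fst (hGx : ∀ y, IsSqLin fun x => G x y)
    (hGy : ∀ x, IsSqLin fun y => G x y)
    (hAx : ∀ y, IsSqLin fun x => A x y) (hAy : ∀ x, IsSqLin fun y => A x y)
    (hBx : ∀ y, IsQuad fun x => B x y) (hBy : ∀ x, IsQuad fun y => B x y)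
    (h : ∀ x y, B x y ^ 2 - 4 * A x y * G x y = x * y) (hG : ∀ x y, G x y = G 0 y) :
    (∀ x y, G x y = G 0 0) ∧ ∀ y, y ≠ 0 → A 0 y ≠ 0 := by
  have key : ∀ y, y ≠ 0 → ∃ r s, r ≠ 0 ∧ s ≠ 0 ∧ ∀ x, A x y = (r * x + s) ^ 2 := by
    intro y hy
    rcases slice_cases hGx hAx hBx h hy with ⟨-, hc⟩ | ⟨-, r, s, hr, hs, hc⟩
    · exact hc
    · have h1 := hG 1 y
      have h2 := hG (-1) y
      simp only [hc] at h1 h2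
      exact absurd (by linear_combination (h1 + h2) / 2) (pow_ne_zero 2 hr)
  refine ⟨?_, fun y hy => ?_⟩
  · rcases indep_fst_or_indep_fst (G := fun y x => G x y) (A := fun y x => A x y)
      (B := fun y x => B x y) hGy hGx hAy hAx hBy (fun y x => by rw [h, mul_comm]) with h0 | h0
    · exact fun x y => by rw [hG, ← h0 y 0]
    · obtain ⟨r, s, hr, hs, hA⟩ := key 1 one_ne_zero
      refine absurd (fun y => ?_)
        ((hBy (-s / r)).not_sq_eq_linear (div_ne_zero (neg_ne_zero.mpr hs) hr))
      have hz : A (-s / r) y = 0 := by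
        rw [h0 y, ← h0 1, hA]
        field_simp
        ring
      rw [← h, hz]
      ring
  · obtain ⟨r, s, -, hs, hA⟩ := key y hy
    rw [hA]
    simpa using hs

theorem const_or_const (hGx : ∀ y, IsSqLin fun x => G x y)
    (hGy : ∀ x, IsSqLin fun y => G x y)
    (hAx : ∀ y, IsSqLin fun x => A x y) (hAy : ∀ x, IsSqLin fun y => A x y)
    (hBx : ∀ y, IsQuad fun x => B x y) (hBy : ∀ x, IsQuad fun y => B x y)
    (h : ∀ x y, B x y ^ 2 - 4 * A x y * G x y = x * y) :
    ((∀ x y, G x y = G 0 0) ∧ ∀ y, y ≠ 0 → A 0 y ≠ 0) ∨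
      ((∀ x y, A x y = A 0 0) ∧ A 0 0 ≠ 0) := by
  rcases indep_fst_or_indep_fst hGx hGy hAx hAy hBx h with hG | hA
  · exact Or.inl (const_of_indep_fst hGx hGy hAx hAy hBx hBy h hG)
  · have hA := (const_of_indep_fst hAx hAy hGx hGy hBx hBy
      (fun x y => by rw [← h x y]; ring) hA).1
    refine Or.inr ⟨hA, fun h0 => (hBy 1).not_sq_eq_linear one_ne_zero fun y => ?_⟩
    rw [← h, hA, h0]
    ring

end Faces

/-- If `f` is quadratic in `x` with discriminant linear in `z`, then its top and bottom
coefficients with respect to `z` are squares. -/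
theorem isSqLin_coeffs {f : ℂ → ℂ → ℂ} {k : ℂ} {a b c a' b' c' : ℂ → ℂ}
    (h : ∀ x z, f x z = a z * x ^ 2 + b z * x + c z)
    (hd : ∀ z, b z ^ 2 - 4 * a z * c z = k * z)
    (h' : ∀ x z, f x z = a' x * z ^ 2 + b' x * z + c' x) :
    IsSqLin a' ∧ IsQuad b' ∧ IsSqLin c' := by
  have e : ∀ x z, a' x * z ^ 2 + b' x * z + c' x = a z * x ^ 2 + b z * x + c z :=
    fun x z => by rw [← h', h]
  have ha' : ∀ x, a' x = (a 1 + a (-1) - 2 * a 0) / 2 * x ^ 2 +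
      (b 1 + b (-1) - 2 * b 0) / 2 * x + (c 1 + c (-1) - 2 * c 0) / 2 := fun x => by
    linear_combination (e x 1 + e x (-1) - 2 * e x 0) / 2
  have hb' : ∀ x, b' x = (a 1 - a (-1)) / 2 * x ^ 2 +
      (b 1 - b (-1)) / 2 * x + (c 1 - c (-1)) / 2 := fun x => by
    linear_combination (e x 1 - e x (-1)) / 2
  have hc' : ∀ x, c' x = a 0 * x ^ 2 + b 0 * x + c 0 := fun x => by
    linear_combination e x 0
  refine ⟨isSqLin_of_disc_eq_zero ha' ?_, ⟨_, _, _, hb'⟩,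
    isSqLin_of_disc_eq_zero hc' (by rw [hd]; ring)⟩
  have ha : ∀ z, a z = (a 1 + a (-1) - 2 * a 0) / 2 * z ^ 2 + (a 1 - a (-1)) / 2 * z + a 0 :=
    fun z => by
      have e0 := e 0 z
      have e1 := e 1 z
      have e2 := e (-1) z
      rw [ha', hb', hc'] at e0 e1 e2
      linear_combination -(e1 + e2 - 2 * e0) / 2
  have hb : ∀ z, b z = (b 1 + b (-1) - 2 * b 0) / 2 * z ^ 2 + (b 1 - b (-1)) / 2 * z + b 0 :=
    fun z => by
      have e1 := e 1 z
      have e2 := e (-1) z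
      rw [ha', hb', hc'] at e1 e2
      linear_combination -(e1 - e2) / 2
  have hc : ∀ z, c z = (c 1 + c (-1) - 2 * c 0) / 2 * z ^ 2 + (c 1 - c (-1)) / 2 * z + c 0 :=
    fun z => by
      have e0 := e 0 z
      rw [ha', hb', hc'] at e0
      linear_combination -e0
  generalize (a 1 + a (-1) - 2 * a 0) / 2 = a₂ at *
  generalize (b 1 + b (-1) - 2 * b 0) / 2 = b₂ at *
  generalize (c 1 + c (-1) - 2 * c 0) / 2 = c₂ at *
  generalize (a 1 - a (-1)) / 2 = a₁ at *
  generalize (b 1 - b (-1)) / 2 = b₁ at *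
  generalize (c 1 - c (-1)) / 2 = c₁ at *
  generalize a 0 = a₀ at *
  generalize b 0 = b₀ at *
  generalize c 0 = c₀ at *
  exact (quartic_coeff_eq_zero_s7 (c₄ := b₂ ^ 2 - 4 * a₂ * c₂)
    (c₃ := 2 * b₂ * b₁ - 4 * (a₂ * c₁ + a₁ * c₂))
    (c₂ := 2 * b₂ * b₀ + b₁ ^ 2 - 4 * (a₂ * c₀ + a₁ * c₁ + a₀ * c₂))
    (c₁ := 2 * b₁ * b₀ - 4 * (a₁ * c₀ + a₀ * c₁) - k)
    (c₀ := b₀ ^ 2 - 4 * a₀ * c₀) (fun z => by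
      have := hd z
      rw [ha, hb, hc] at this
      linear_combination this)).2.2.2.2

/-- Either the restriction to `x3 = 0` or the coefficient of `x3 ^ 2` (written as half of a
second difference) is constant. -/
theorem StronglyDiscSep.restrict_or_coeff_const {F : ℂ → ℂ → ℂ → ℂ}
    (hF : StronglyDiscSep F fun x => x) :
    ((∀ x y, F x y 0 = F 0 0 0) ∧ ∀ y, y ≠ 0 → F 0 y 1 + F 0 y (-1) - 2 * F 0 y 0 ≠ 0) ∨
      ∃ a, a ≠ 0 ∧ ∀ x y, F x y 1 + F x y (-1) - 2 * F x y 0 = 2 * a := by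
  obtain ⟨⟨A₁, B₁, C₁, h₁, d₁⟩, ⟨A₂, B₂, C₂, h₂, d₂⟩, A, B, G, h, d⟩ := hF
  have hx : ∀ y, IsSqLin (fun x => A x y) ∧ IsQuad (fun x => B x y) ∧ IsSqLin fun x => G x y :=
    fun y => isSqLin_coeffs (f := fun x z => F x y z) (k := y) (fun x z => h₁ x y z)
      (fun z => d₁ y z) (fun x z => h x y z)
  have hy : ∀ x, IsSqLin (fun y => A x y) ∧ IsQuad (fun y => B x y) ∧ IsSqLin fun y => G x y :=
    fun x => isSqLin_coeffs (f := fun y z => F x y z) (k := x) (fun y z => h₂ x y z)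
      (fun z => d₂ x z) (fun y z => h x y z)
  have hA : ∀ x y, F x y 1 + F x y (-1) - 2 * F x y 0 = 2 * A x y := fun x y => by
    simp only [h]; ring
  have hG : ∀ x y, F x y 0 = G x y := fun x y => by
    simp only [h]; ring
  rcases const_or_const (fun y => (hx y).2.2) (fun x => (hy x).2.2) (fun y => (hx y).1)
    (fun x => (hy x).1) (fun y => (hx y).2.1) (fun x => (hy x).2.1) d with ⟨h0, h1⟩ | ⟨h0, h1⟩
  · exact Or.inl ⟨fun x y => by rw [hG, hG, h0],
      fun y hy => by rw [hA]; exact mul_ne_zero two_ne_zero (h1 y hy)⟩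
  · exact Or.inr ⟨A 0 0, h1, fun x y => by rw [hA, h0]⟩

theorem StronglyDiscSep.rotate {F : ℂ → ℂ → ℂ → ℂ} (hF : StronglyDiscSep F fun x => x) :
    StronglyDiscSep (fun x y z => F z x y) fun x => x := by
  obtain ⟨⟨A₁, B₁, C₁, h₁, d₁⟩, ⟨A₂, B₂, C₂, h₂, d₂⟩, A, B, C, h, d⟩ := hF
  exact ⟨⟨fun y z => A₂ z y, fun y z => B₂ z y, fun y z => C₂ z y,
      fun x y z => h₂ z x y, fun y z => (d₂ z y).trans (mul_comm z y)⟩,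
    ⟨fun x z => A z x, fun x z => B z x, fun x z => C z x,
      fun x y z => h z x y, fun x z => (d z x).trans (mul_comm z x)⟩,
    ⟨A₁, B₁, C₁, fun x y z => h₁ z x y, d₁⟩⟩

theorem StronglyDiscSep.coeff_const {F : ℂ → ℂ → ℂ → ℂ}
    (hF : StronglyDiscSep F fun x => x) :
    ∃ a, ∀ x y, F x y 1 + F x y (-1) - 2 * F x y 0 = 2 * a := by
  rcases hF.restrict_or_coeff_const with ⟨hG, hA⟩ | ⟨a, -, ha⟩
  · rcases hF.rotate.restrict_or_coeff_const with ⟨hG', -⟩ | ⟨a, ha, h⟩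
    · exact absurd (by simp only [hG' 1 1, hG' 1 (-1), hG' 1 0]; ring) (hA 1 one_ne_zero)
    · have := h 0 0
      simp only [hG] at this
      exact absurd (by linear_combination -this / 2) ha
  · exact ⟨a, ha⟩

theorem IsDiscWrt3.eq_second_difference {F : ℂ → ℂ → ℂ → ℂ} {D : ℂ → ℂ → ℂ}
    (h : IsDiscWrt3 F D) {a : ℂ} (ha : ∀ x y, F x y 1 + F x y (-1) - 2 * F x y 0 = 2 * a)
    (x y z : ℂ) : F x y z = a * z ^ 2 + (F x y 1 - F x y 0 - a) * z + F x y 0 := by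
  obtain ⟨A, B, C, h, -⟩ := h
  have hA := ha x y
  simp only [h] at hA ⊢
  linear_combination (z ^ 2 - z) * hA / 2

theorem IsDiscWrt3.disc_eq {F : ℂ → ℂ → ℂ → ℂ} {D : ℂ → ℂ → ℂ}
    (h : IsDiscWrt3 F D) {a : ℂ} (ha : ∀ x y, F x y 1 + F x y (-1) - 2 * F x y 0 = 2 * a)
    (x y : ℂ) : (F x y 1 - F x y 0 - a) ^ 2 - 4 * a * F x y 0 = D x y := by
  obtain ⟨A, B, C, h, d⟩ := h
  have hA := ha x y
  have hA' : a = A x y := by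
    simp only [h] at hA
    linear_combination -hA / 2
  rw [← d, hA']
  simp only [h]
  ring

theorem multiaffine_disc_coeffs {a b c d e f k l m n w : ℂ}
    (h : ∀ x y : ℂ, (n + f * x + e * y + k * x * y) ^ 2 -
      4 * c * (a * x ^ 2 + b * y ^ 2 + d * x * y + l * x + m * y + w) = x * y) :
    k = 0 ∧ f ^ 2 = 4 * c * a ∧ e ^ 2 = 4 * c * b ∧ n * f = 2 * c * l ∧ n * e = 2 * c * m ∧
      n ^ 2 = 4 * c * w ∧ 2 * e * f - 4 * c * d = 1 := by
  have hx := fun y => quartic_coeff_eq_zero_s7 (c₄ := 0) (c₃ := 0)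
    (c₂ := (f + k * y) ^ 2 - 4 * c * a)
    (c₁ := 2 * (n + e * y) * (f + k * y) - 4 * c * (d * y + l) - y)
    (c₀ := (n + e * y) ^ 2 - 4 * c * (b * y ^ 2 + m * y + w))
    (fun x => by linear_combination h x y)
  obtain ⟨u0, u1, u2, -, -⟩ := quartic_coeff_eq_zero_s7 (c₄ := 0) (c₃ := 0)
    (c₂ := k ^ 2) (c₁ := 2 * f * k) (c₀ := f ^ 2 - 4 * c * a)
    (fun y => by linear_combination (hx y).2.2.1)
  obtain ⟨v0, v1, -, -, -⟩ := quartic_coeff_eq_zero_s7 (c₄ := 0) (c₃ := 0)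
    (c₂ := 2 * e * k) (c₁ := 2 * e * f + 2 * n * k - 4 * c * d - 1) (c₀ := 2 * n * f - 4 * c * l)
    (fun y => by linear_combination (hx y).2.1)
  obtain ⟨w0, w1, w2, -, -⟩ := quartic_coeff_eq_zero_s7 (c₄ := 0) (c₃ := 0)
    (c₂ := e ^ 2 - 4 * c * b) (c₁ := 2 * n * e - 4 * c * m) (c₀ := n ^ 2 - 4 * c * w)
    (fun y => by linear_combination (hx y).1)
  have hk : k = 0 := by simpa using u2
  refine ⟨hk, ?_, ?_, ?_, ?_, ?_, ?_⟩
  · linear_combination u0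
  · linear_combination w2
  · linear_combination v0 / 2
  · linear_combination w1 / 2
  · linear_combination w0
  · rw [hk] at v1
    linear_combination v1

theorem StronglyDiscSep.exists_coeffs {F : ℂ → ℂ → ℂ → ℂ} (hF : StronglyDiscSep F fun x => x) :
    ∃ a b c d e f k l m n w : ℂ,
      (∀ x y z, F x y z = a * x ^ 2 + b * y ^ 2 + c * z ^ 2 + d * x * y + e * y * z + f * x * z +
        k * x * y * z + l * x + m * y + n * z + w) ∧
      (∀ x y : ℂ, (n + f * x + e * y + k * x * y) ^ 2 -
        4 * c * (a * x ^ 2 + b * y ^ 2 + d * x * y + l * x + m * y + w) = x * y) ∧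
      (∀ y z : ℂ, (l + d * y + f * z + k * y * z) ^ 2 -
        4 * a * (b * y ^ 2 + c * z ^ 2 + e * y * z + m * y + n * z + w) = y * z) ∧
      (∀ z x : ℂ, (m + e * z + d * x + k * z * x) ^ 2 -
        4 * b * (c * z ^ 2 + a * x ^ 2 + f * z * x + n * z + l * x + w) = z * x) := by
  obtain ⟨c, hc⟩ := hF.coeff_const
  obtain ⟨a, ha⟩ := hF.rotate.coeff_const
  obtain ⟨b, hb⟩ := hF.rotate.rotate.coeff_const
  have ez := hF.2.2.eq_second_difference hc
  have ex := hF.rotate.2.2.eq_second_difference ha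
  have ey := hF.rotate.rotate.2.2.eq_second_difference hb
  have dz := hF.2.2.disc_eq hc
  have dx := hF.rotate.2.2.disc_eq ha
  have dy := hF.rotate.rotate.2.2.disc_eq hb
  dsimp only at ex ey dz dx dy
  obtain ⟨d, e, f, k, l, m, n, w, h⟩ : ∃ d e f k l m n w : ℂ, ∀ x y z,
      F x y z = a * x ^ 2 + b * y ^ 2 + c * z ^ 2 + d * x * y + e * y * z + f * x * z +
        k * x * y * z + l * x + m * y + n * z + w := by
    refine ⟨F 1 1 0 - F 1 0 0 - F 0 1 0 + F 0 0 0, F 0 1 1 - F 0 1 0 - F 0 0 1 + F 0 0 0,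
      F 1 0 1 - F 1 0 0 - F 0 0 1 + F 0 0 0,
      F 1 1 1 - F 1 1 0 - F 1 0 1 - F 0 1 1 + F 1 0 0 + F 0 1 0 + F 0 0 1 - F 0 0 0,
      F 1 0 0 - F 0 0 0 - a, F 0 1 0 - F 0 0 0 - b, F 0 0 1 - F 0 0 0 - c, F 0 0 0,
      fun x y z => ?_⟩
    rw [ez x y z, ey 0 x y, ey 1 x y, ex 0 0 x, ex 0 1 x, ex 1 0 x, ex 1 1 x]
    ring
  refine ⟨a, b, c, d, e, f, k, l, m, n, w, h, fun x y => ?_, fun y z => ?_, fun z x => ?_⟩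
  · rw [← dz x y, h, h]
    ring
  · rw [← dx y z, h, h]
    ring
  · rw [← dy z x, h, h]
    ring

/-- Converse of case (D): if `D_{x_i} F = x_j x_k` identically for every permutation
`(i,j,k)` of `(1,2,3)`, then `F = ε·(-½(x1x2+x2x3+x1x3) + ¼(x1²+x2²+x3²))` with `ε ∈ {1,-1}`.
(The hypothesis `StronglyDiscSep F id` encodes, via the quadratic decompositions in each
variable, that `F` has degree at most two in each variable.) -/
theorem statement7 (F : ℂ → ℂ → ℂ → ℂ)
    (hF : StronglyDiscSep F (fun x => x)) :
    ∃ e : ℂ, (e = 1 ∨ e = -1) ∧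
      ∀ x1 x2 x3, F x1 x2 x3 =
        e * (-(1 / 2) * (x1 * x2 + x2 * x3 + x1 * x3) + (1 / 4) * (x1 ^ 2 + x2 ^ 2 + x3 ^ 2)) := by
  obtain ⟨a, b, c, d, e, f, k, l, m, n, w, h, hz, hx, hy⟩ := hF.exists_coeffs
  obtain ⟨hk, hca, hcb, nl, nm, nw, h₃⟩ := multiaffine_disc_coeffs hz
  obtain ⟨-, hab, -, lm, -, -, h₁⟩ := multiaffine_disc_coeffs hx
  obtain ⟨-, -, -, -, -, -, h₂⟩ := multiaffine_disc_coeffs hy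
  have hde : d = e := by
    linear_combination -d * h₃ + e * h₁ - 4 * c * hab + 4 * a * hcb
  have hdf : d = f := by
    linear_combination -d * h₃ + f * h₂ - 4 * c * hab + 4 * b * hca
  subst hde hdf
  have hd : d ≠ 0 := by
    rintro rfl
    have hc : c * (a * b) = 0 := by linear_combination -c * hab / 4
    simp_all
  have hc : c ≠ 0 := by
    rintro rfl
    exact hd (by simpa using hca)
  have ha : a ≠ 0 := by
    rintro rfl
    exact hd (by simpa using hca)
  obtain rfl : a = b := mul_left_cancel₀ hc (by linear_combination (hcb - hca) / 4)
  obtain rfl : a = c := mul_left_cancel₀ ha (by linear_combination (hca - hab) / 4)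
  have hd2 : d = -2 * a := by
    have : (d - 2 * a) * (d + 2 * a) = 0 := by linear_combination hab
    rcases mul_eq_zero.mp this with h0 | h0
    · exact absurd (by linear_combination h₁ - 2 * d * h0) (zero_ne_one (α := ℂ))
    · linear_combination h0
  subst hd2
  have hnl : n = -l := mul_left_cancel₀ ha (by linear_combination -nl / 2)
  have hnm : n = -m := mul_left_cancel₀ ha (by linear_combination -nm / 2)
  have hlm : l = -m := mul_left_cancel₀ ha (by linear_combination -lm / 2)
  have hm : m = 0 := by linear_combination (hnm - hnl + hlm) / 2
  have hl : l = 0 := by rw [hlm, hm, neg_zero]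
  have hn : n = 0 := by rw [hnm, hm, neg_zero]
  have hw : w = 0 := by
    rw [hn] at nw
    simpa [ha] using nw.symm
  refine ⟨4 * a, ?_, fun x y z => ?_⟩
  · exact eq_or_eq_neg_of_sq_eq_sq _ _ (by linear_combination h₁)
  · rw [h, hk, hl, hm, hn, hw]
    ring
end

section
/- Let k ∈ ℂ, k ≠ 0, and define F_{A1}(x1,x2,x3) = (−(k²/2)x1² − (k²/2)x2² + ½ + (k²/2)x1²x2²)x3² + (1−k²)x1x2x3 + ½x1² + ½x2² − (k²/2)x1²x2² − ½ and F_{A3}(x1,x2,x3) = (k/2 − (k/2)x1² − (k/2)x2² + (k³/2)x1²x2²)x3² + (1−k²)x1x2x3 + (k/2)x1² + (k/2)x2² − (k/2)x1²x2² − 1/(2k). Then there exist ε ∈ {1,−1} and a nonzero constant c ∈ ℂ such that for all x1, x2, x3 ∈ ℂ with x1x2x3 ≠ 0: (x1x2x3)² · F_{A3}(ε/(kx1), ε/(kx2), ε/(kx3)) = c · F_{A1}(x1,x2,x3); i.e., F_{A1} and F_{A3} are equivalent under the Möbius transformation x ↦ ε/(kx) applied simultaneously to all three variables, up to a nonzero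 multiplicative constant. -/
/-- The solution `F_{A1}` from case (A) of Theorem 1. -/
noncomputable def FA1 (k x1 x2 x3 : ℂ) : ℂ :=
  (-(k ^ 2 / 2) * x1 ^ 2 - (k ^ 2 / 2) * x2 ^ 2 + 1 / 2 + (k ^ 2 / 2) * x1 ^ 2 * x2 ^ 2) * x3 ^ 2
    + (1 - k ^ 2) * x1 * x2 * x3
    + (1 / 2) * x1 ^ 2 + (1 / 2) * x2 ^ 2 - (k ^ 2 / 2) * x1 ^ 2 * x2 ^ 2 - 1 / 2

/-- The solution `F_{A3}` from case (A) of Theorem 1. -/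
noncomputable def FA3 (k x1 x2 x3 : ℂ) : ℂ :=
  (k / 2 - (k / 2) * x1 ^ 2 - (k / 2) * x2 ^ 2 + (k ^ 3 / 2) * x1 ^ 2 * x2 ^ 2) * x3 ^ 2
    + (1 - k ^ 2) * x1 * x2 * x3
    + (k / 2) * x1 ^ 2 + (k / 2) * x2 ^ 2 - (k / 2) * x1 ^ 2 * x2 ^ 2 - 1 / (2 * k)

/-- `F_{A1}` and `F_{A3}` are gauge equivalent under the Möbius transformation
`x ↦ ε/(kx)` applied simultaneously to all three variables, up to a nonzero constant. -/
theorem statement8 (k : ℂ) (hk : k ≠ 0) :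
    ∃ e c : ℂ, (e = 1 ∨ e = -1) ∧ c ≠ 0 ∧
      ∀ x1 x2 x3 : ℂ, x1 * x2 * x3 ≠ 0 →
        (x1 * x2 * x3) ^ 2 * FA3 k (e / (k * x1)) (e / (k * x2)) (e / (k * x3))
          = c * FA1 k x1 x2 x3 := by
  refine ⟨-1, -1 / k ^ 3, Or.inr rfl, by simp [hk], fun x1 x2 x3 hx => ?_⟩
  obtain ⟨⟨h1, h2⟩, h3⟩ : (x1 ≠ 0 ∧ x2 ≠ 0) ∧ x3 ≠ 0 := by
    simpa only [mul_ne_zero_iff] using hx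
  unfold FA1 FA3
  field_simp
  ring
end

section
/- Let l, l1, c, k ∈ ℂ and define Q(s,x1,x2) = (x1−x2)²(s − l1/2)² − R(x1,x2)(s − l1/2) − ¼R1(x1,x2), where R(x1,x2) = −x1²x2² + 6l1x1x2 + 2lc(x1+x2) + c² − k² and R1(x1,x2) = −6l1x1²x2² − (c²−k²)(x1+x2)² − 4lcx1x2(x1+x2) + 6l1(c²−k²) − 4c²l². Define J(s) = 4s³ + (c² − k² − 3l1²)s − l²c² + l1³ − l1k² + l1c² and P(x) = −x⁴ + 6l1x² + 4lcx + c² − k². Then the discriminant of Q with respect to x1 (viewing Q as a quadratic polynomial in x1) equals J(s)·P(x2) identically in s and x2, and likewise the discriminant of Q with respect to x2 equals J(s)·P(x1). -/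
/-- `R(x1,x2)` from the fundamental Kowalevski equation. -/
def Rk (l l1 c k x1 x2 : ℂ) : ℂ :=
  -x1 ^ 2 * x2 ^ 2 + 6 * l1 * x1 * x2 + 2 * l * c * (x1 + x2) + c ^ 2 - k ^ 2

/-- `R1(x1,x2)` from the fundamental Kowalevski equation. -/
def R1k (l l1 c k x1 x2 : ℂ) : ℂ :=
  -6 * l1 * x1 ^ 2 * x2 ^ 2 - (c ^ 2 - k ^ 2) * (x1 + x2) ^ 2
    - 4 * l * c * x1 * x2 * (x1 + x2) + 6 * l1 * (c ^ 2 - k ^ 2) - 4 * c ^ 2 * l ^ 2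

/-- `P(x) = -x⁴ + 6l1x² + 4lcx + c² - k²`. -/
def Pk (l l1 c k x : ℂ) : ℂ :=
  -x ^ 4 + 6 * l1 * x ^ 2 + 4 * l * c * x + c ^ 2 - k ^ 2

/-- The fundamental Kowalevski equation
`Q(s,x1,x2) = (x1-x2)²(s - l1/2)² - R(x1,x2)(s - l1/2) - ¼R1(x1,x2)`. -/
noncomputable def Qk (l l1 c k s x1 x2 : ℂ) : ℂ :=
  (x1 - x2) ^ 2 * (s - l1 / 2) ^ 2 - Rk l l1 c k x1 x2 * (s - l1 / 2)
    - (1 / 4) * R1k l l1 c k x1 x2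

/-- `J(s) = 4s³ + (c² - k² - 3l1²)s - l²c² + l1³ - l1k² + l1c²`. -/
def Jk (l l1 c k s : ℂ) : ℂ :=
  4 * s ^ 3 + (c ^ 2 - k ^ 2 - 3 * l1 ^ 2) * s - l ^ 2 * c ^ 2 + l1 ^ 3
    - l1 * k ^ 2 + l1 * c ^ 2

/-- The leading coefficient of `Q` as a quadratic in one variable, the other being `y`. -/
noncomputable def quadCoeff (l l1 c k s y : ℂ) : ℂ :=
  (s - l1 / 2) ^ 2 + y ^ 2 * (s - l1 / 2)
    + (6 * l1 * y ^ 2 + (c ^ 2 - k ^ 2) + 4 * l * c * y) / 4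

/-- The linear coefficient of `Q` as a quadratic in one variable, the other being `y`. -/
noncomputable def linCoeff (l l1 c k s y : ℂ) : ℂ :=
  -2 * y * (s - l1 / 2) ^ 2 - 6 * l1 * y * (s - l1 / 2) - 2 * l * c * (s - l1 / 2)
    + (c ^ 2 - k ^ 2) * y / 2 + l * c * y ^ 2

/-- The constant coefficient of `Q` as a quadratic in one variable, the other being `y`. -/
noncomputable def constCoeff (l l1 c k s y : ℂ) : ℂ :=
  y ^ 2 * (s - l1 / 2) ^ 2 - 2 * l * c * y * (s - l1 / 2) - (c ^ 2 - k ^ 2) * (s - l1 / 2)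
    + (c ^ 2 - k ^ 2) * y ^ 2 / 4 - 3 / 2 * l1 * (c ^ 2 - k ^ 2) + c ^ 2 * l ^ 2

lemma Qk_eq_quadratic (l l1 c k s x y : ℂ) :
    Qk l l1 c k s x y =
      quadCoeff l l1 c k s y * x ^ 2 + linCoeff l l1 c k s y * x + constCoeff l l1 c k s y := by
  simp only [Qk, Rk, R1k, quadCoeff, linCoeff, constCoeff]
  ring

lemma Qk_symm (l l1 c k s x y : ℂ) : Qk l l1 c k s x y = Qk l l1 c k s y x := by
  simp only [Qk, Rk, R1k]
  ring

lemma discrim_eq_Jk_mul_Pk (l l1 c k s y : ℂ) :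
    linCoeff l l1 c k s y ^ 2 - 4 * quadCoeff l l1 c k s y * constCoeff l l1 c k s y =
      Jk l l1 c k s * Pk l l1 c k y := by
  simp only [Jk, Pk, quadCoeff, linCoeff, constCoeff]
  ring

/-- The discriminant of the Kowalevski equation `Q` with respect to `x1` equals
`J(s)·P(x2)` identically, and likewise its discriminant with respect to `x2`
equals `J(s)·P(x1)`. -/
theorem statement12 (l l1 c k : ℂ) :
    (∃ A B C : ℂ → ℂ → ℂ,
      (∀ s x1 x2, Qk l l1 c k s x1 x2 = A s x2 * x1 ^ 2 + B s x2 * x1 + C s x2) ∧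
      (∀ s x2, (B s x2) ^ 2 - 4 * A s x2 * C s x2 = Jk l l1 c k s * Pk l l1 c k x2)) ∧
    (∃ A B C : ℂ → ℂ → ℂ,
      (∀ s x1 x2, Qk l l1 c k s x1 x2 = A s x1 * x2 ^ 2 + B s x1 * x2 + C s x1) ∧
      (∀ s x1, (B s x1) ^ 2 - 4 * A s x1 * C s x1 = Jk l l1 c k s * Pk l l1 c k x1)) := by
  exact ⟨⟨quadCoeff l l1 c k, linCoeff l l1 c k, constCoeff l l1 c k,
      fun s x1 x2 => Qk_eq_quadratic l l1 c k s x1 x2, discrim_eq_Jk_mul_Pk l l1 c k⟩,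
    ⟨quadCoeff l l1 c k, linCoeff l l1 c k, constCoeff l l1 c k,
      fun s x1 x2 => (Qk_symm l l1 c k s x1 x2).trans (Qk_eq_quadratic l l1 c k s x2 x1),
      discrim_eq_Jk_mul_Pk l l1 c k⟩⟩
end

section
/- Let a, a0, a1 ∈ ℂ with a ≠ 0, a ≠ 1, a0 ≠ 0. Define L(x1,x2) = (x1−x2)², K(x1,x2) = a0(aa0+4a1−4a0)x1²x2² − 2a0(aa1+2a1−2a0)x1x2(x1+x2) + (2a1a0(1+2a) − aa0² − 2aa1² − 2a0²)(x1²+x2²) + 4aa1²x1x2 − 2aa0a1(x1+x2) + aa0², and H(x1,x2) = 4a0x1²x2² − 2a0(a+2)x1x2(x1+x2) + (a0+2aa0−aa1)(x1²+x2²) + 2(a0+2aa0+aa1)x1x2 − 2aa0(x1+x2), and set F(x1,x2,s) = L(x1,x2)s² − (K(x1,x2)/(aa0))s + ((a0−aa1)(a1−a0)²/(a0²a²))·H(x1,x2). Let P(x) = (x−1)²((4(a0−a1)−aa0)x² + 2a(2a1−a0)x − aa0). Then there exists a constant c ∈ ℂ such that the discriminant of F with respect to s, namely (K(x1,x2)/(aa0))²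 − 4L(x1,x2)·((a0−aa1)(a1−a0)²/(a0²a²))·H(x1,x2), equals c·P(x1)·P(x2) for all x1, x2 ∈ ℂ. -/
/-- `L(x1,x2) = (x1-x2)²`. -/
def LB (x1 x2 : ℂ) : ℂ := (x1 - x2) ^ 2

/-- `K(x1,x2)` for the pencil of type (1,1,2) (case (B)). -/
def KB (a a0 a1 x1 x2 : ℂ) : ℂ :=
  a0 * (a * a0 + 4 * a1 - 4 * a0) * x1 ^ 2 * x2 ^ 2
    - 2 * a0 * (a * a1 + 2 * a1 - 2 * a0) * x1 * x2 * (x1 + x2)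
    + (2 * a1 * a0 * (1 + 2 * a) - a * a0 ^ 2 - 2 * a * a1 ^ 2 - 2 * a0 ^ 2)
        * (x1 ^ 2 + x2 ^ 2)
    + 4 * a * a1 ^ 2 * x1 * x2 - 2 * a * a0 * a1 * (x1 + x2) + a * a0 ^ 2

/-- `H(x1,x2)` for the pencil of type (1,1,2) (case (B)). -/
def HB (a a0 a1 x1 x2 : ℂ) : ℂ :=
  4 * a0 * x1 ^ 2 * x2 ^ 2 - 2 * a0 * (a + 2) * x1 * x2 * (x1 + x2)
    + (a0 + 2 * a * a0 - a * a1) * (x1 ^ 2 + x2 ^ 2)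
    + 2 * (a0 + 2 * a * a0 + a * a1) * x1 * x2 - 2 * a * a0 * (x1 + x2)

/-- `P(x) = (x-1)²((4(a0-a1)-aa0)x² + 2a(2a1-a0)x - aa0)`. -/
def PB' (a a0 a1 x : ℂ) : ℂ :=
  (x - 1) ^ 2 * ((4 * (a0 - a1) - a * a0) * x ^ 2 + 2 * a * (2 * a1 - a0) * x - a * a0)

/-- The pencil equation of case (B) in Darboux coordinates. -/
noncomputable def FBpencil (a a0 a1 x1 x2 s : ℂ) : ℂ :=
  LB x1 x2 * s ^ 2 - (KB a a0 a1 x1 x2 / (a * a0)) * s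
    + ((a0 - a * a1) * (a1 - a0) ^ 2 / (a0 ^ 2 * a ^ 2)) * HB a a0 a1 x1 x2

/-- The discriminant with respect to `s` of the pencil equation of type (1,1,2)
equals `c·P(x1)·P(x2)` for some constant `c`. -/
theorem statement13 (a a0 a1 : ℂ) (ha : a ≠ 0) (ha' : a ≠ 1) (ha0 : a0 ≠ 0) :
    ∃ c : ℂ, ∀ x1 x2 : ℂ,
      (KB a a0 a1 x1 x2 / (a * a0)) ^ 2
        - 4 * LB x1 x2 * ((a0 - a * a1) * (a1 - a0) ^ 2 / (a0 ^ 2 * a ^ 2))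
            * HB a a0 a1 x1 x2
      = c * PB' a a0 a1 x1 * PB' a a0 a1 x2 := by
  refine ⟨1 / a ^ 2, fun x1 x2 => ?_⟩
  unfold KB LB HB PB'
  field_simp
  ring
end

section
/- Let a, a0, a1 ∈ ℂ with a ≠ 0, a ≠ 1, a0 ≠ 0. With L, K, H and F(x1,x2,s) = L(x1,x2)s² − (K(x1,x2)/(aa0))s + ((a0−aa1)(a1−a0)²/(a0²a²))·H(x1,x2) defined by L(x1,x2) = (x1−x2)², K(x1,x2) = a0(aa0+4a1−4a0)x1²x2² − 2a0(aa1+2a1−2a0)x1x2(x1+x2) + (2a1a0(1+2a) − aa0² − 2aa1² − 2a0²)(x1²+x2²) + 4aa1²x1x2 − 2aa0a1(x1+x2) + aa0², H(x1,x2) = 4a0x1²x2² − 2a0(a+2)x1x2(x1+x2) + (a0+2aa0−aa1)(x1²+x2²) + 2(a0+2aa0+aa1)x1x2 − 2aa0(x1+x2), let s0 = (a0−a1)(aa1−a0)/(aa0) be the double root of J(s) = (sa0 + (a0−a1)²)(saa0 + (aa1−a0)(a1−a0))². Then there exists a constant c ∈ ℂ such that F(x1,x2,s0) = c·(x1−1)²(x2−1)²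 for all x1, x2 ∈ ℂ; i.e., the conic of the pencil corresponding to the double root of J is the double common tangent line at the point of tangency R. -/
/-- Substituting the double root `s0 = (a0-a1)(aa1-a0)/(aa0)` of
`J(s) = (sa0 + (a0-a1)²)(saa0 + (aa1-a0)(a1-a0))²` into the pencil equation gives the
double common tangent line at the point of tangency: `F(x1,x2,s0) = c(x1-1)²(x2-1)²`. -/
theorem statement14 (a a0 a1 : ℂ) (ha : a ≠ 0) (ha' : a ≠ 1) (ha0 : a0 ≠ 0) :
    ∃ c : ℂ, ∀ x1 x2 : ℂ,
      FBpencil a a0 a1 x1 x2 ((a0 - a1) * (a * a1 - a0) / (a * a0))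
        = c * (x1 - 1) ^ 2 * (x2 - 1) ^ 2 := by
  refine ⟨-((a0 - a1) * (a * a1 - a0) / a), fun x1 x2 => ?_⟩
  unfold FBpencil LB KB HB
  field_simp
  ring
end

section
/- Let a, a3, a4 ∈ ℂ with a ≠ 1 and d := 3a4 − 4a3 + aa4 ≠ 0. Define L(x1,x2) = (x1−x2)², K(x1,x2) = (aa4²−4a3a4+3a4²)x1²x2² − 2a3(3a4−4a3+aa4)x1x2(x1+x2) + (6a3a4(1+a) − 2aa3² − 3aa4² − a4² − 6a3²)(x1²+x2²) + (48a3a4 + 4aa3² − 36a3² − 16a4²)x1x2 + 2(2a4−3a3)(3a4−4a3+aa4)(x1+x2) − (3a4−4a3)(3a4−4a3+aa4), and H(x1,x2) = 4(aa4+3a4−4a3)x1²x2² − 2(a+3)(3a4−4a3+aa4)x1x2(x1+x2) + (3a4a² + 6aa4 + 7a4 − a²a3 − 6aa3 − 9a3)(x1²+x2²) + (22a4 − 36aa3 + 6a4a² − 30a3 + 2a²a3 + 36aa4)x1x2 − 2(1+3a)(3a4−4a3+aa4)(x1+x2) + 4a(3a4−4a3+aa4), and set F(x1,x2,s) = L(x1,x2)s²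 − (K(x1,x2)/d)s + ((a4−a3)³/d²)·H(x1,x2). Let P(x) = (x−1)³(a4x + 3a4 − 4a3). Then there exists a constant c ∈ ℂ such that the discriminant of F with respect to s, namely (K(x1,x2)/d)² − 4L(x1,x2)·((a4−a3)³/d²)·H(x1,x2), equals c·P(x1)·P(x2) for all x1, x2 ∈ ℂ. -/
/-- `L(x1,x2) = (x1-x2)²`. -/
def LD (x1 x2 : ℂ) : ℂ := (x1 - x2) ^ 2

/-- `K(x1,x2)` for the pencil of type (1,3) (case (D)). -/
def KD (a a3 a4 x1 x2 : ℂ) : ℂ :=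
  (a * a4 ^ 2 - 4 * a3 * a4 + 3 * a4 ^ 2) * x1 ^ 2 * x2 ^ 2
    - 2 * a3 * (3 * a4 - 4 * a3 + a * a4) * x1 * x2 * (x1 + x2)
    + (6 * a3 * a4 * (1 + a) - 2 * a * a3 ^ 2 - 3 * a * a4 ^ 2 - a4 ^ 2 - 6 * a3 ^ 2)
        * (x1 ^ 2 + x2 ^ 2)
    + (48 * a3 * a4 + 4 * a * a3 ^ 2 - 36 * a3 ^ 2 - 16 * a4 ^ 2) * x1 * x2
    + 2 * (2 * a4 - 3 * a3) * (3 * a4 - 4 * a3 + a * a4) * (x1 + x2)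
    - (3 * a4 - 4 * a3) * (3 * a4 - 4 * a3 + a * a4)

/-- `H(x1,x2)` for the pencil of type (1,3) (case (D)). -/
def HD (a a3 a4 x1 x2 : ℂ) : ℂ :=
  4 * (a * a4 + 3 * a4 - 4 * a3) * x1 ^ 2 * x2 ^ 2
    - 2 * (a + 3) * (3 * a4 - 4 * a3 + a * a4) * x1 * x2 * (x1 + x2)
    + (3 * a4 * a ^ 2 + 6 * a * a4 + 7 * a4 - a ^ 2 * a3 - 6 * a * a3 - 9 * a3)
        * (x1 ^ 2 + x2 ^ 2)
    + (22 * a4 - 36 * a * a3 + 6 * a4 * a ^ 2 - 30 * a3 + 2 * a ^ 2 * a3 + 36 * a * a4)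
        * x1 * x2
    - 2 * (1 + 3 * a) * (3 * a4 - 4 * a3 + a * a4) * (x1 + x2)
    + 4 * a * (3 * a4 - 4 * a3 + a * a4)

/-- `P(x) = (x-1)³(a4x + 3a4 - 4a3)`. -/
def PD' (a3 a4 x : ℂ) : ℂ := (x - 1) ^ 3 * (a4 * x + 3 * a4 - 4 * a3)

/-- The discriminant identity with denominators cleared. -/
theorem discriminant_cleared (a a3 a4 x1 x2 : ℂ) :
    KD a a3 a4 x1 x2 ^ 2 - 4 * LD x1 x2 * (a4 - a3) ^ 3 * HD a a3 a4 x1 x2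
      = (3 * a4 - 4 * a3 + a * a4) ^ 2 * (PD' a3 a4 x1 * PD' a3 a4 x2) := by
  unfold KD LD HD PD'
  ring

/-- The discriminant with respect to `s` of the pencil equation of type (1,3),
`F(x1,x2,s) = L s² - (K/d) s + ((a4-a3)³/d²) H` with `d = 3a4 - 4a3 + aa4`,
equals `c·P(x1)·P(x2)` for some constant `c`. -/
theorem statement15 (a a3 a4 : ℂ) (ha : a ≠ 1)
    (hd : 3 * a4 - 4 * a3 + a * a4 ≠ 0) :
    ∃ c : ℂ, ∀ x1 x2 : ℂ,
      (KD a a3 a4 x1 x2 / (3 * a4 - 4 * a3 + a * a4)) ^ 2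
        - 4 * LD x1 x2 * ((a4 - a3) ^ 3 / (3 * a4 - 4 * a3 + a * a4) ^ 2)
            * HD a a3 a4 x1 x2
      = c * PD' a3 a4 x1 * PD' a3 a4 x2 := by
  refine ⟨1, fun x1 x2 => ?_⟩
  have h := discriminant_cleared a a3 a4 x1 x2
  generalize 3 * a4 - 4 * a3 + a * a4 = d at hd h ⊢
  field_simp
  linear_combination h
end

section
/- Let k, α, c ∈ ℂ with c ≠ 0 and c² = P_A(α), where P_A(x) = (k²x²−1)(x²−1). Define the biquadratic polynomial ĥ(x1,x2) = F_A(x1,x2,α)/c, where F_A(x1,x2,x3) = ½(k²x1²x2² − k²x1² − k²x2² + 1)x3² + (1−k²)x1x2x3 + ½(x1² + x2² − k²x1²x2² − 1). Then for all x1, x2 ∈ ℂ: (∂ĥ/∂x1)² − 2ĥ·(∂²ĥ/∂x1²) = P_A(x2) and (∂ĥ/∂x2)² − 2ĥ·(∂²ĥ/∂x2²) = P_A(x1). In particular, the discriminants of ĥ do not depend on the parameter α. -/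
/-- Normalized biquadratic `ĥ(x1,x2) = F_A(x1,x2,α)/c` with `c² = P_A(α)`. -/
noncomputable def hA (k α c x1 x2 : ℂ) : ℂ := FA k x1 x2 α / c

theorem deriv_quadratic (a b d : ℂ) :
    deriv (fun t : ℂ => a * t ^ 2 + b * t + d) = fun t => 2 * a * t + b := by
  funext x
  have h := (((hasDerivAt_id x).pow 2).const_mul a).add ((hasDerivAt_id x).const_mul b)
  refine ((h.add_const d).congr_deriv ?_).deriv
  simp only [id]
  norm_num
  ring

theorem deriv_deriv_quadratic (a b d x : ℂ) :
    deriv (deriv (fun t : ℂ => a * t ^ 2 + b * t + d)) x = 2 * a := by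
  rw [deriv_quadratic]
  exact (((hasDerivAt_id x).const_mul (2 * a)).add_const b |>.congr_deriv (mul_one _)).deriv

/-- The operator `δ` sends a quadratic polynomial to its discriminant. -/
theorem deriv_sq_sub_quadratic (a b d x : ℂ) :
    (deriv (fun t : ℂ => a * t ^ 2 + b * t + d) x) ^ 2
      - 2 * (a * x ^ 2 + b * x + d) * deriv (deriv (fun t : ℂ => a * t ^ 2 + b * t + d)) x
      = b ^ 2 - 4 * a * d := by
  rw [deriv_deriv_quadratic, deriv_quadratic]
  ring

theorem hA_comm (k α c x1 x2 : ℂ) : hA k α c x1 x2 = hA k α c x2 x1 := by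
  unfold hA FA
  ring

theorem hA_eq_quadratic (k α c t y : ℂ) :
    hA k α c t y =
      ((k ^ 2 * y ^ 2 * α ^ 2 - k ^ 2 * α ^ 2 + 1 - k ^ 2 * y ^ 2) / (2 * c)) * t ^ 2
        + ((1 - k ^ 2) * y * α / c) * t
        + (α ^ 2 - k ^ 2 * y ^ 2 * α ^ 2 + y ^ 2 - 1) / (2 * c) := by
  unfold hA FA
  ring

theorem deriv_sq_sub_hA (k α c : ℂ) (hc : c ≠ 0) (hcP : c ^ 2 = PA k α) (x y : ℂ) :
    (deriv (fun t => hA k α c t y) x) ^ 2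
      - 2 * hA k α c x y * deriv (deriv (fun t => hA k α c t y)) x = PA k y := by
  simp only [hA_eq_quadratic]
  rw [deriv_sq_sub_quadratic]
  field_simp
  rw [hcP]
  unfold PA
  ring

/-- Proposition 1, case `I = A`: the discriminant-like operators
`δ_{x_i}(ĥ) = ĥ_{x_i}² - 2ĥ·ĥ_{x_i x_i}` of `ĥ = F_A(·,·,α)/√(P_A(α))` satisfy
`δ_{x1}(ĥ) = P_A(x2)` and `δ_{x2}(ĥ) = P_A(x1)`, independently of `α`. -/
theorem statement17 (k α c : ℂ) (hc : c ≠ 0) (hcP : c ^ 2 = PA k α) :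
    (∀ x1 x2 : ℂ,
      (deriv (fun t => hA k α c t x2) x1) ^ 2
        - 2 * hA k α c x1 x2 * deriv (deriv (fun t => hA k α c t x2)) x1
      = PA k x2) ∧
    (∀ x1 x2 : ℂ,
      (deriv (fun t => hA k α c x1 t) x2) ^ 2
        - 2 * hA k α c x1 x2 * deriv (deriv (fun t => hA k α c x1 t)) x2
      = PA k x1) := by
  refine ⟨deriv_sq_sub_hA k α c hc hcP, fun x1 x2 => ?_⟩
  simp only [hA_comm k α c x1]
  exact deriv_sq_sub_hA k α c hc hcP x2 x1
end

section
/- Let e, α, c ∈ ℂ with e ≠ 0, c ≠ 0, and c² = P_B(α), where P_B(x) = x² − e². Define the biquadratic polynomial ĥ(x1,x2) = F_B(x1,x2,α)/c, where F_B(x1,x2,x3) = x1x2x3 + (e/2)(x1² + x2² + x3² − e²). Then for all x1, x2 ∈ ℂ: (∂ĥ/∂x1)² − 2ĥ·(∂²ĥ/∂x1²) = P_B(x2) and (∂ĥ/∂x2)² − 2ĥ·(∂²ĥ/∂x2²) = P_B(x1). In particular, the discriminants of ĥ do not depend on the parameter α. -/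
/-- Case (B): `P_B(x) = x² - e²`. -/
def PB (e x : ℂ) : ℂ := x ^ 2 - e ^ 2

/-- Case (B): the strongly discriminantly separable polynomial `F_B`. -/
noncomputable def FB (e x1 x2 x3 : ℂ) : ℂ :=
  x1 * x2 * x3 + (e / 2) * (x1 ^ 2 + x2 ^ 2 + x3 ^ 2 - e ^ 2)

/-- Normalized biquadratic `ĥ(x1,x2) = F_B(x1,x2,α)/c` with `c² = P_B(α)`. -/
noncomputable def hB (e α c x1 x2 : ℂ) : ℂ := FB e x1 x2 α / c

/-- The discriminant-like operator of a quadratic polynomial is its discriminant. -/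
theorem deriv_sq_sub_two_mul_quadratic (a b d x : ℂ) :
    (deriv (fun t : ℂ => a * t ^ 2 + b * t + d) x) ^ 2
        - 2 * (a * x ^ 2 + b * x + d) * deriv (deriv (fun t : ℂ => a * t ^ 2 + b * t + d)) x
      = discrim a b d := by
  have h1 : deriv (fun t : ℂ => a * t ^ 2 + b * t + d) = fun t => 2 * a * t + b := by
    funext t
    have h := ((((hasDerivAt_id t).pow 2).const_mul a).add
      ((hasDerivAt_id t).const_mul b)).add_const d
    refine (h.congr_deriv ?_).deriv
    simp
    ring
  have h2 : deriv (fun t : ℂ => 2 * a * t + b) x = 2 * a := by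
    simp
  rw [h1, h2, discrim]
  ring

theorem hB_comm (e α c x1 x2 : ℂ) : hB e α c x1 x2 = hB e α c x2 x1 := by
  unfold hB FB
  ring

theorem hB_eq_quadratic (e α c x1 x2 : ℂ) :
    hB e α c x1 x2 = e / (2 * c) * x1 ^ 2 + x2 * α / c * x1
      + e / (2 * c) * (x2 ^ 2 + α ^ 2 - e ^ 2) := by
  unfold hB FB
  ring

theorem deriv_sq_sub_two_mul_hB {e α c : ℂ} (hc : c ≠ 0) (hcP : c ^ 2 = PB e α) (x1 x2 : ℂ) :
    (deriv (fun t => hB e α c t x2) x1) ^ 2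
        - 2 * hB e α c x1 x2 * deriv (deriv (fun t => hB e α c t x2)) x1
      = PB e x2 := by
  simp only [hB_eq_quadratic]
  rw [deriv_sq_sub_two_mul_quadratic, discrim]
  unfold PB at *
  field_simp
  rw [hcP]
  ring

/-- Proposition 1, case `I = B`: the discriminant-like operators
`δ_{x_i}(ĥ) = ĥ_{x_i}² - 2ĥ·ĥ_{x_i x_i}` of `ĥ = F_B(·,·,α)/√(P_B(α))` satisfy
`δ_{x1}(ĥ) = P_B(x2)` and `δ_{x2}(ĥ) = P_B(x1)`, independently of `α`. -/
theorem statement18 (e α c : ℂ) (he : e ≠ 0) (hc : c ≠ 0) (hcP : c ^ 2 = PB e α) :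
    (∀ x1 x2 : ℂ,
      (deriv (fun t => hB e α c t x2) x1) ^ 2
        - 2 * hB e α c x1 x2 * deriv (deriv (fun t => hB e α c t x2)) x1
      = PB e x2) ∧
    (∀ x1 x2 : ℂ,
      (deriv (fun t => hB e α c x1 t) x2) ^ 2
        - 2 * hB e α c x1 x2 * deriv (deriv (fun t => hB e α c x1 t)) x2
      = PB e x1) := by
  refine ⟨deriv_sq_sub_two_mul_hB hc hcP, fun x1 x2 => ?_⟩
  simp only [hB_comm e α c x1]
  exact deriv_sq_sub_two_mul_hB hc hcP x2 x1
end
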